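/- If (C,D,h) ∈ W_n and f_h : C → D is an associated map extending h, then f_h(Int C) ⊆ Int D and, for every x₀ ∈ Int C, the induced homomorphism π₁(Int C, x₀) → π₁(Int D, f_h(x₀)) is surjective. (Corollary 3.1) -/

import Mathlib

noncomputable section

open Metric Set unitInterval

/-- The ambient Euclidean space `ℝ^{n+1}` in which the sphere `S^n` lives. -/
abbrev Amb (n : ℕ) := EuclideanSpace ℝ (Fin (n + 1))

/-- The unit sphere `S^n` inside `ℝ^{n+1}`. -/
def Sph (n : ℕ) : Set (Amb n) := Metric.sphere 0 1

/-- A crumpled `n`-cube: the union of the image `bd` of a topological embedding of the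
sphere `S^{n-1}` into `S^n` together with one of the connected components `int` of
`S^n \ bd`. -/
structure CrumpledCube (n : ℕ) where
  bd : Set (Amb n)
  int : Set (Amb n)
  bd_subset_sphere : bd ⊆ Sph n
  exists_embedding : ∃ e : ↥(Sph (n - 1)) → Amb n,
      Continuous e ∧ Function.Injective e ∧ Set.range e = bd
  int_component : ∃ x, x ∈ Sph n \ bd ∧ int = connectedComponentIn (Sph n \ bd) x

namespace CrumpledCube

/-- The underlying set of a crumpled cube. -/
def carrier {n : ℕ} (C : CrumpledCube n) : Set (Amb n) := C.bd ∪ C.int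

lemma bd_subset_carrier {n : ℕ} (C : CrumpledCube n) : C.bd ⊆ C.carrier :=
  Set.subset_union_left

end CrumpledCube

/-- `f : C → D` is a map associated with the triple `(C, D, h)`: it is continuous,
restricts to `h` on `Bd C`, and satisfies `f⁻¹(Bd D) = Bd C`. -/
def IsAssociatedMap {n : ℕ} (C D : CrumpledCube n) (h : ↥C.bd ≃ₜ ↥D.bd)
    (f : ↥C.carrier → ↥D.carrier) : Prop :=
  Continuous f ∧
    (∀ (x : ↥C.carrier) (hx : (x : Amb n) ∈ C.bd),
      ((f x : ↥D.carrier) : Amb n) = ((h ⟨(x : Amb n), hx⟩ : ↥D.bd) : Amb n)) ∧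
    (∀ x : ↥C.carrier, ((f x : ↥D.carrier) : Amb n) ∈ D.bd ↔ (x : Amb n) ∈ C.bd)

/-- The triple `(C, D, h)` belongs to the collection `𝒲_n`. -/
def MemW {n : ℕ} (C D : CrumpledCube n) (h : ↥C.bd ≃ₜ ↥D.bd) : Prop :=
  ∃ f : ↥C.carrier → ↥D.carrier, IsAssociatedMap C D h f

/-- The image `h(T)` of a subset `T` of `Bd C` under a boundary homeomorphism
`h : Bd C → Bd D`, as a subset of the ambient space. -/
def bdImage {n : ℕ} {C D : CrumpledCube n} (h : ↥C.bd ≃ₜ ↥D.bd) (T : Set (Amb n)) :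
    Set (Amb n) :=
  (fun x : ↥C.bd => ((h x : ↥D.bd) : Amb n)) '' {x : ↥C.bd | (x : Amb n) ∈ T}

/-- `T` is a homotopy taming set for the crumpled cube `C`. -/
def IsHomotopyTamingSet {n : ℕ} (C : CrumpledCube n) (T : Set (Amb n)) : Prop :=
  T ⊆ C.bd ∧
    ∀ (m : C(I × I, ↥C.carrier)) (ε : ℝ), 0 < ε →
      ∃ m' : C(I × I, ↥C.carrier),
        (∀ x, dist (m x) (m' x) < ε) ∧ ∀ x, ((m' x : ↥C.carrier) : Amb n) ∈ T ∪ C.int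

/-- `Bd C` is locally collared in `C` at the point `p`. -/
def LocallyCollaredAt {n : ℕ} (C : CrumpledCube n) (p : ↥C.carrier) : Prop :=
  ∃ N : Set ↥C.carrier, IsOpen N ∧ p ∈ N ∧
    ∃ φ : ↥N ≃ₜ ↥(N ∩ {x : ↥C.carrier | (x : Amb n) ∈ C.bd}) × ↥(Set.Ico (0 : ℝ) 1),
      ∀ (x : ↥N) (hx : ((x : ↥C.carrier) : Amb n) ∈ C.bd),
        φ x = (⟨(x : ↥C.carrier), ⟨x.2, hx⟩⟩, ⟨0, ⟨le_rfl, zero_lt_one⟩⟩)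

/-- The wild set of a crumpled cube: the points of `Bd C` at which `Bd C` fails to be
locally collared in `C`. -/
def wildSet {n : ℕ} (C : CrumpledCube n) : Set (Amb n) :=
  {p | ∃ hp : p ∈ C.bd, ¬ LocallyCollaredAt C ⟨p, C.bd_subset_carrier hp⟩}

/-- `C` is strictly wilder than `D`. -/
def StrictlyWilder {n : ℕ} (C D : CrumpledCube n) : Prop :=
  (∃ h : ↥C.bd ≃ₜ ↥D.bd, MemW C D h) ∧ ∀ H : ↥D.bd ≃ₜ ↥C.bd, ¬ MemW D C H

/-- A crumpled `n`-cube is a closed `n`-cell-complement if the complement of its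
interior in `S^n` is an `n`-cell. -/
def IsClosedCellComplement {n : ℕ} (C : CrumpledCube n) : Prop :=
  Nonempty (↥(Sph n \ C.int) ≃ₜ ↥(Metric.closedBall (0 : EuclideanSpace ℝ (Fin n)) 1))

section NullLagrangian

open MeasureTheory
open scoped Pointwise

variable {E : Type*} [NormedAddCommGroup E] [NormedSpace ℝ E] [FiniteDimensional ℝ E]

lemma ContinuousLinearMap.det_smul_id_sub_pos (A : E →L[ℝ] E) {t : ℝ} (ht : ‖A‖ < t) :
    0 < (t • ContinuousLinearMap.id ℝ E - A).det := by
  have key : ∀ s ∈ Icc (0 : ℝ) 1, (t • ContinuousLinearMap.id ℝ E - s • A).det ≠ 0 := by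
    intro s hs h0
    have h1 : ¬ Function.Injective (t • ContinuousLinearMap.id ℝ E - s • A : E →L[ℝ] E) := by
      intro hinj
      have := LinearMap.bot_lt_ker_of_det_eq_zero
        (f := ((t • ContinuousLinearMap.id ℝ E - s • A : E →L[ℝ] E) : E →ₗ[ℝ] E)) h0
      rw [LinearMap.ker_eq_bot.2 hinj] at this
      exact lt_irrefl _ this
    apply h1
    rw [injective_iff_map_eq_zero]
    intro x hx
    by_contra hne
    have hx' : t • x = s • A x := by simpa [sub_eq_zero] using hx
    have hpos : 0 < ‖x‖ := norm_pos_iff.2 hne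
    have h2 : ‖t • x‖ = t * ‖x‖ := by
      rw [norm_smul, Real.norm_of_nonneg ((norm_nonneg A).trans ht.le)]
    have h3 : ‖s • A x‖ ≤ 1 * (‖A‖ * ‖x‖) := by
      rw [norm_smul, Real.norm_of_nonneg hs.1]
      exact mul_le_mul hs.2 (A.le_opNorm x) (norm_nonneg _) zero_le_one
    rw [hx'] at h2
    nlinarith
  have hcont : Continuous fun s : ℝ => (t • ContinuousLinearMap.id ℝ E - s • A).det :=
    ContinuousLinearMap.continuous_det.comp (by fun_prop)
  have h0 : 0 < (t • ContinuousLinearMap.id ℝ E - (0 : ℝ) • A).det := by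
    have ht0 : 0 < t := (norm_nonneg A).trans_lt ht
    simp only [zero_smul, sub_zero, ContinuousLinearMap.det, ContinuousLinearMap.toLinearMap_smul,
      LinearMap.det_smul, ContinuousLinearMap.coe_id, LinearMap.det_id, mul_one]
    positivity
  by_contra hneg
  rw [not_lt] at hneg
  have hneg' : (t • ContinuousLinearMap.id ℝ E - (1 : ℝ) • A).det ≤ 0 := by simpa using hneg
  obtain ⟨s, hs, hs0⟩ := intermediate_value_Icc' zero_le_one hcont.continuousOn ⟨hneg', h0.le⟩
  exact key s hs hs0

lemma LipschitzWith.bijective_smul_sub {f : E → E} {K : NNReal} (hf : LipschitzWith K f) {t : ℝ}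
    (ht : (K : ℝ) < t) : Function.Bijective fun x => t • x - f x := by
  have ht0 : 0 < t := K.coe_nonneg.trans_lt ht
  refine ⟨fun x y hxy => ?_, fun y => ?_⟩
  · by_contra hne
    have h1 : t • (x - y) = f x - f y := by
      have : t • x - f x = t • y - f y := hxy
      rw [smul_sub, sub_eq_sub_iff_add_eq_add]
      rw [sub_eq_sub_iff_add_eq_add] at this
      rw [this, add_comm]
    have h2 := hf.norm_sub_le x y
    rw [← h1, norm_smul, Real.norm_of_nonneg ht0.le] at h2
    have : 0 < ‖x - y‖ := norm_pos_iff.2 (sub_ne_zero.2 hne)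
    nlinarith
  · have hc : ContractingWith (K / t.toNNReal) fun x => t⁻¹ • (y + f x) := by
      refine ⟨?_, ?_⟩
      · rw [div_lt_one (by simpa using ht0)]
        exact NNReal.coe_lt_coe.1 (by simpa [ht0.le] using ht)
      · refine LipschitzWith.of_dist_le_mul fun a b => ?_
        rw [dist_smul₀, dist_add_left, NNReal.coe_div, Real.coe_toNNReal _ ht0.le, norm_inv,
          Real.norm_of_nonneg ht0.le, div_mul_eq_mul_div, inv_mul_eq_div]
        exact div_le_div_of_nonneg_right (hf.dist_le_mul a b) ht0.le
    have : CompleteSpace E := FiniteDimensional.complete ℝ E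
    have : Nonempty E := ⟨0⟩
    refine ⟨hc.fixedPoint _, ?_⟩
    have := hc.fixedPoint_isFixedPt
    simp only [Function.IsFixedPt] at this
    change t • hc.fixedPoint _ - f _ = y
    nth_rewrite 1 [← this]
    rw [smul_inv_smul₀ ht0.ne']
    abel

variable [MeasurableSpace E] [BorelSpace E] (μ : Measure E) [μ.IsAddHaarMeasure]

lemma setIntegral_det_smul_id_sub_fderiv {f : E → E} (hf : ContDiff ℝ 1 f) {K : NNReal}
    (hK : LipschitzWith K f) {R t : ℝ} (hR : ∀ x, R < ‖x‖ → f x = 0) (ht : (K : ℝ) < t) :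
    ∫ x in closedBall (0 : E) R, (t • ContinuousLinearMap.id ℝ E - fderiv ℝ f x).det ∂μ =
      t ^ Module.finrank ℝ E * μ.real (closedBall (0 : E) R) := by
  have ht0 : 0 < t := K.coe_nonneg.trans_lt ht
  set B := closedBall (0 : E) R
  have hbij := hK.bijective_smul_sub ht
  have himg : (fun x => t • x - f x) '' B = t • B := by
    have hc : ∀ x ∉ B, t • x - f x = t • x := fun x hx => by
      rw [hR x (by simpa [B] using hx), sub_zero]
    have h1 : ((fun x => t • x - f x) '' B)ᶜ = (t • B)ᶜ := by
      rw [← image_compl_eq hbij, ← image_smul, ← image_compl_eq (f := fun x : E => t • x)]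
      · exact image_congr hc
      · exact (MulAction.bijective (Units.mk0 t ht0.ne'))
    exact compl_injective h1
  have hder : ∀ x ∈ B, HasFDerivWithinAt (fun x => t • x - f x)
      (t • ContinuousLinearMap.id ℝ E - fderiv ℝ f x) B x := fun x _ =>
    (((hasFDerivAt_id x).const_smul t).sub
      (hf.differentiable one_ne_zero x).hasFDerivAt).hasFDerivWithinAt
  have hmain := integral_image_eq_integral_abs_det_fderiv_smul μ
    (isClosed_closedBall.measurableSet : MeasurableSet B) hder hbij.1.injOn (fun _ => (1 : ℝ))
  have hpos : ∀ x, |(t • ContinuousLinearMap.id ℝ E - fderiv ℝ f x).det| • (1 : ℝ) =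
      (t • ContinuousLinearMap.id ℝ E - fderiv ℝ f x).det := fun x => by
    rw [smul_eq_mul, mul_one, abs_of_pos]
    exact ContinuousLinearMap.det_smul_id_sub_pos _
      ((norm_fderiv_le_of_lipschitz ℝ hK).trans_lt ht)
  simp only [hpos] at hmain
  rw [← hmain, himg]
  simp only [integral_const, smul_eq_mul, mul_one, measureReal_restrict_apply_univ]
  rw [measureReal_def, Measure.addHaar_smul, ENNReal.toReal_mul, abs_of_nonneg (by positivity),
    ENNReal.toReal_ofReal (by positivity), measureReal_def]

lemma integral_det_fderiv_eq_zero [Nontrivial E] {f : E → E} (hf : ContDiff ℝ 1 f)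
    (hc : HasCompactSupport f) : ∫ x, (fderiv ℝ f x).det ∂μ = 0 := by
  obtain ⟨K, hK⟩ := ContDiff.lipschitzWith_of_hasCompactSupport hc hf one_ne_zero
  obtain ⟨R, hR⟩ := hc.isCompact.isBounded.subset_closedBall (0 : E)
  set B := closedBall (0 : E) R
  have hR0 : ∀ x, R < ‖x‖ → f x = 0 := fun x hx => by
    by_contra h
    exact hx.not_ge (mem_closedBall_zero_iff.1 (hR (subset_tsupport f h)))
  set N := Module.finrank ℝ E
  have hN : N ≠ 0 := (Module.finrank_pos).ne'
  let s : Finset ℕ := Finset.range (N + 1)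
  let v : ℕ → ℝ := fun i => K + 1 + i
  have hv : InjOn v s := fun i _ j _ hij => by simpa [v] using hij
  have hlag : ∀ p : Polynomial ℝ, p.natDegree ≤ N →
      p.eval 0 = ∑ i ∈ s, p.eval (v i) * (Lagrange.basis s v i).eval 0 := fun p hp => by
    have := Lagrange.eq_interpolate (f := p) hv (by
      rw [Finset.card_range]
      exact (Polynomial.degree_le_natDegree).trans_lt (by exact_mod_cast Nat.lt_succ_of_le hp))
    conv_lhs => rw [this]
    simp [Lagrange.interpolate_apply, Polynomial.eval_finsetSum]
  have hdet : ∀ (A : E →L[ℝ] E) (t : ℝ), ((A : E →ₗ[ℝ] E).charpoly).eval t =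
      (t • ContinuousLinearMap.id ℝ E - A).det := fun A t => by
    rw [LinearMap.eval_charpoly]; rfl
  have hneg : ∀ x, (fderiv ℝ f x).det = (-1) ^ N * ∑ i ∈ s,
      (v i • ContinuousLinearMap.id ℝ E - fderiv ℝ f x).det *
        (Lagrange.basis s v i).eval 0 := fun x => by
    have h1 := hlag ((fderiv ℝ f x : E →L[ℝ] E) : E →ₗ[ℝ] E).charpoly
      (LinearMap.charpoly_natDegree _).le
    simp only [hdet] at h1
    rw [← h1, zero_smul, zero_sub]
    have h2 : (-fderiv ℝ f x).det = (-1) ^ N * (fderiv ℝ f x).det := by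
      have := LinearMap.det_smul (-1 : ℝ) (fderiv ℝ f x : E →ₗ[ℝ] E)
      simpa [ContinuousLinearMap.det] using this
    rw [h2, ← mul_assoc, ← mul_pow]
    simp
  have hcont : ∀ t : ℝ, Continuous fun x =>
      (t • ContinuousLinearMap.id ℝ E - fderiv ℝ f x).det := fun t =>
    ContinuousLinearMap.continuous_det.comp
      (continuous_const.sub (hf.continuous_fderiv one_ne_zero))
  have hset : ∫ x, (fderiv ℝ f x).det ∂μ = ∫ x in B, (fderiv ℝ f x).det ∂μ := by
    symm
    refine setIntegral_eq_integral_of_forall_compl_eq_zero fun x hx => ?_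
    have : fderiv ℝ f x = 0 := by
      by_contra h
      exact hx (hR (support_fderiv_subset ℝ h))
    rw [this, ContinuousLinearMap.det, ContinuousLinearMap.toLinearMap_zero, LinearMap.det_zero,
      zero_pow hN]
  rw [hset]
  simp only [hneg]
  rw [integral_const_mul, integral_finsetSum]
  · simp only [integral_mul_const]
    have h2 : ∀ i ∈ s, (∫ x in B, (v i • ContinuousLinearMap.id ℝ E - fderiv ℝ f x).det ∂μ) *
        (Lagrange.basis s v i).eval 0 = μ.real B *
          ((Polynomial.X ^ N : Polynomial ℝ).eval (v i) * (Lagrange.basis s v i).eval 0) :=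
      fun i _ => by
        rw [setIntegral_det_smul_id_sub_fderiv μ hf hK hR0 (by
          have : (0 : ℝ) ≤ i := i.cast_nonneg
          simp only [v]; linarith)]
        simp only [Polynomial.eval_pow, Polynomial.eval_X]
        ring
    rw [Finset.sum_congr rfl h2, ← Finset.mul_sum, ← hlag _ (Polynomial.natDegree_X_pow_le N)]
    simp [hN]
  · intro i _
    exact ((hcont (v i)).continuousOn.integrableOn_compact (isCompact_closedBall _ _)).mul_const _

end NullLagrangian

section SmoothDegree

open MeasureTheory Filter Topology

lemma exists_contDiff_cutoff {E : Type*} [NormedAddCommGroup E] [NormedSpace ℝ E]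
    [FiniteDimensional ℝ E] {K W : Set E} (hK : IsCompact K) (hW : IsOpen W) (hKW : K ⊆ W) :
    ∃ (χ : E → ℝ) (L : Set E), ContDiff ℝ 1 χ ∧ IsCompact L ∧ L ⊆ W ∧ (∀ x ∉ L, χ x = 0) ∧
      (∀ x ∈ K, ∀ᶠ y in 𝓝 x, χ y = 1) ∧ ∀ x, χ x ∈ Icc (0 : ℝ) 1 := by
  obtain ⟨L, hL, hKL, hLW⟩ := exists_compact_between hK hW hKW
  obtain ⟨χ, h1, h0, h01⟩ := exists_contMDiffMap_one_nhds_of_subset_interior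
    (modelWithCornersSelf ℝ E) (n := 1) hK.isClosed hKL
  exact ⟨χ, L, contMDiff_iff_contDiff.1 χ.contMDiff, hL, hLW, h0,
    fun x hx => h1.filter_mono (nhds_le_nhdsSet hx), h01⟩

lemma setIntegral_det_fderiv_congr {E : Type*} [NormedAddCommGroup E] [NormedSpace ℝ E]
    [FiniteDimensional ℝ E] [Nontrivial E] [MeasurableSpace E] [BorelSpace E] (μ : Measure E)
    [μ.IsAddHaarMeasure] {f g : E → E} (hf : ContDiff ℝ 1 f) (hg : ContDiff ℝ 1 g) {K W : Set E}
    (hW : IsOpen W) (hWb : Bornology.IsBounded W) (hK : IsClosed K) (hKW : K ⊆ W)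
    (hfg : ∀ x ∉ K, f x = g x) :
    ∫ x in W, (fderiv ℝ f x).det ∂μ = ∫ x in W, (fderiv ℝ g x).det ∂μ := by
  obtain ⟨χ, L, hχ, hL, -, hχL, hχ1, -⟩ := exists_contDiff_cutoff
    (K := closure W) (Metric.isCompact_of_isClosed_isBounded isClosed_closure hWb.closure)
    isOpen_univ (subset_univ _)
  have hcs : ∀ u : E → E, HasCompactSupport fun x => χ x • u x := fun u =>
    HasCompactSupport.intro hL fun x hx => by simp [hχL x hx]
  have hcd : ∀ u : E → E, ContDiff ℝ 1 u → ContDiff ℝ 1 fun x => χ x • u x := fun u hu =>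
    hχ.smul hu
  have hint : ∀ u : E → E, ContDiff ℝ 1 u →
      Integrable (fun x => (fderiv ℝ (fun x => χ x • u x) x).det) μ := fun u hu => by
    refine (ContinuousLinearMap.continuous_det.comp
      ((hcd u hu).continuous_fderiv one_ne_zero)).integrable_of_hasCompactSupport ?_
    refine ((hcs u).fderiv (𝕜 := ℝ)).comp_left (g := fun A : E →L[ℝ] E => A.det) ?_
    simp [ContinuousLinearMap.det]
  have hon : ∀ u : E → E, ContDiff ℝ 1 u → ∫ x in W, (fderiv ℝ u x).det ∂μ =
      - ∫ x in Wᶜ, (fderiv ℝ (fun x => χ x • u x) x).det ∂μ := fun u hu => by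
    have h1 := integral_add_compl hW.measurableSet (hint u hu)
    rw [integral_det_fderiv_eq_zero μ (hcd u hu) (hcs u)] at h1
    rw [← eq_neg_of_add_eq_zero_left h1]
    refine setIntegral_congr_fun hW.measurableSet fun x hx => ?_
    have : (fun y => χ y • u y) =ᶠ[𝓝 x] u := by
      filter_upwards [hχ1 x (subset_closure hx)] with y hy
      rw [hy, one_smul]
    simp only [this.fderiv_eq]
  rw [hon f hf, hon g hg]
  congr 1
  refine setIntegral_congr_fun hW.measurableSet.compl fun x hx => ?_
  have : (fun y => χ y • f y) =ᶠ[𝓝 x] fun y => χ y • g y := by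
    filter_upwards [hK.isOpen_compl.mem_nhds fun h => hx (hKW h)] with y hy
    rw [hfg y hy]
  simp only [this.fderiv_eq]

/-- A smooth monotone function equal to `0` on `(-∞, -1]` and to `1` on `[1, ∞)`. -/
def ramp (t : ℝ) : ℝ := Real.smoothTransition ((t + 1) / 2)

lemma contDiff_ramp {k : ℕ∞} : ContDiff ℝ k ramp :=
  Real.smoothTransition.contDiff.comp ((contDiff_id.add contDiff_const).div_const 2)

lemma monotone_ramp : Monotone ramp := fun a b hab =>
  Real.smoothTransition.monotone (by linarith)

lemma deriv_ramp_nonneg (t : ℝ) : 0 ≤ deriv ramp t := monotone_ramp.deriv_nonneg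

lemma continuous_deriv_ramp : Continuous (deriv ramp) :=
  (contDiff_ramp (k := 1)).continuous_deriv le_rfl

lemma deriv_ramp_eq_zero {t : ℝ} (ht : 1 < |t|) : deriv ramp t = 0 := by
  rcases lt_abs.1 ht with h | h
  · have : ramp =ᶠ[𝓝 t] fun _ => 1 := by
      filter_upwards [Ioi_mem_nhds h] with s hs
      exact Real.smoothTransition.one_of_one_le (by have : 1 < s := hs; linarith)
    simp [this.deriv_eq]
  · have : ramp =ᶠ[𝓝 t] fun _ => 0 := by
      filter_upwards [Iio_mem_nhds (show t < -1 by linarith)] with s hs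
      exact Real.smoothTransition.zero_of_nonpos (by have : s < -1 := hs; linarith)
    simp [this.deriv_eq]

lemma hasCompactSupport_deriv_ramp : HasCompactSupport (deriv ramp) :=
  HasCompactSupport.intro (isCompact_Icc (a := (-1 : ℝ)) (b := 1)) fun t ht =>
    deriv_ramp_eq_zero (by
      by_contra h
      exact ht (abs_le.1 (not_lt.1 h)))

lemma integral_deriv_ramp : ∫ t, deriv ramp t = 1 := by
  have := integral_of_hasDerivAt_of_tendsto (f := ramp) (f' := deriv ramp) (m := 0) (n := 1)
    (fun t => ((contDiff_ramp (k := 1)).differentiable one_ne_zero t).hasDerivAt)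
    (continuous_deriv_ramp.integrable_of_hasCompactSupport hasCompactSupport_deriv_ramp)
    (tendsto_const_nhds.congr' (by
      filter_upwards [Iio_mem_atBot (-1 : ℝ)] with s hs
      exact (Real.smoothTransition.zero_of_nonpos (by have : s < -1 := hs; linarith)).symm))
    (tendsto_const_nhds.congr' (by
      filter_upwards [Ioi_mem_atTop (1 : ℝ)] with s hs
      exact (Real.smoothTransition.one_of_one_le (by have : 1 < s := hs; linarith)).symm))
  simpa using this

variable {ι : Type*} [Fintype ι]

/-- The smooth map of `ι → ℝ` collapsing the complement of the unit cube to the boundary of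
a cube. -/
def collapse (y : ι → ℝ) : ι → ℝ := fun i => ramp (y i)

/-- The Jacobian determinant of `collapse`, a bump function of integral `1` supported in the
unit cube. -/
def cubeBump (y : ι → ℝ) : ℝ := ∏ i, deriv ramp (y i)

lemma continuous_cubeBump : Continuous (cubeBump (ι := ι)) :=
  continuous_finsetProd _ fun i _ => continuous_deriv_ramp.comp (continuous_apply i)

lemma cubeBump_nonneg (y : ι → ℝ) : 0 ≤ cubeBump y :=
  Finset.prod_nonneg fun _ _ => deriv_ramp_nonneg _

lemma cubeBump_eq_zero {y : ι → ℝ} (hy : 1 < ‖y‖) : cubeBump y = 0 := by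
  obtain ⟨i, hi⟩ : ∃ i, 1 < |y i| := by
    by_contra! h
    exact hy.not_ge ((pi_norm_le_iff_of_nonneg zero_le_one).2 h)
  exact Finset.prod_eq_zero (Finset.mem_univ i) (deriv_ramp_eq_zero hi)

lemma integral_cubeBump : ∫ y : ι → ℝ, cubeBump y = 1 := by
  have := integral_fintype_prod_eq_prod (𝕜 := ℝ) (ι := ι) (E := fun _ => ℝ)
    (fun _ => deriv ramp) (μ := fun _ => volume)
  simp only [integral_deriv_ramp, Finset.prod_const_one] at this
  exact this

lemma contDiff_collapse {k : ℕ∞} : ContDiff ℝ k (collapse (ι := ι)) :=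
  contDiff_pi.2 fun i => contDiff_ramp.comp (contDiff_apply ℝ ℝ i)

lemma det_fderiv_collapse (y : ι → ℝ) : (fderiv ℝ collapse y).det = cubeBump y := by
  classical
  have h : HasFDerivAt collapse (ContinuousLinearMap.pi fun i =>
      ((ContinuousLinearMap.toSpanSingleton ℝ (deriv ramp (y i))).comp
        (ContinuousLinearMap.proj i : (ι → ℝ) →L[ℝ] ℝ))) y := by
    refine hasFDerivAt_pi.2 fun i => ?_
    have h1 : HasDerivAt ramp (deriv ramp (y i)) (y i) :=
      ((contDiff_ramp (k := 1)).differentiable one_ne_zero (y i)).hasDerivAt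
    exact HasFDerivAt.comp (g := ramp) y h1.hasFDerivAt (hasFDerivAt_apply i y)
  rw [h.fderiv, ContinuousLinearMap.det_pi]
  refine Finset.prod_congr rfl fun i _ => ?_
  simp [ContinuousLinearMap.det, LinearMap.det_ring]

lemma det_fderiv_collapse_comp {f : (ι → ℝ) → ι → ℝ} (hf : ContDiff ℝ 1 f) (x : ι → ℝ) :
    (fderiv ℝ (collapse ∘ f) x).det = cubeBump (f x) * (fderiv ℝ f x).det := by
  rw [fderiv_comp x ((contDiff_collapse (k := 1)).differentiable one_ne_zero _)
    (hf.differentiable one_ne_zero x), ← det_fderiv_collapse]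
  simp [ContinuousLinearMap.det, LinearMap.det_comp]

/-- The integral expression for the degree at `0` on `W` of a `C¹` map `f` with `1 < ‖f‖` on
the frontier of `W`. -/
def smoothDeg (f : (ι → ℝ) → ι → ℝ) (W : Set (ι → ℝ)) : ℝ :=
  ∫ x in W, cubeBump (f x) * (fderiv ℝ f x).det

lemma continuous_cubeBump_mul_det {f : (ι → ℝ) → ι → ℝ} (hf : ContDiff ℝ 1 f) :
    Continuous fun x => cubeBump (f x) * (fderiv ℝ f x).det :=
  (continuous_cubeBump.comp hf.continuous).mul
    (ContinuousLinearMap.continuous_det.comp (hf.continuous_fderiv one_ne_zero))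

lemma integrableOn_cubeBump_mul_det {f : (ι → ℝ) → ι → ℝ} (hf : ContDiff ℝ 1 f)
    {W : Set (ι → ℝ)} (hWb : Bornology.IsBounded W) :
    IntegrableOn (fun x => cubeBump (f x) * (fderiv ℝ f x).det) W :=
  ((continuous_cubeBump_mul_det hf).continuousOn.integrableOn_compact
    (Metric.isCompact_of_isClosed_isBounded isClosed_closure hWb.closure)).mono_set subset_closure

lemma smoothDeg_eq_of_homotopy [Nonempty ι] {f g : (ι → ℝ) → ι → ℝ} (hf : ContDiff ℝ 1 f)
    (hg : ContDiff ℝ 1 g) {W : Set (ι → ℝ)} (hW : IsOpen W) (hWb : Bornology.IsBounded W)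
    (hfg : ∀ x ∈ frontier W, ∀ t ∈ Icc (0 : ℝ) 1, 1 < ‖f x + t • (g x - f x)‖) :
    smoothDeg f W = smoothDeg g W := by
  have hcW : IsCompact (closure W) :=
    Metric.isCompact_of_isClosed_isBounded isClosed_closure hWb.closure
  let M : Set (ι → ℝ) := Prod.fst '' {p : (ι → ℝ) × ℝ | p ∈ closure W ×ˢ Icc (0 : ℝ) 1 ∧
    ‖f p.1 + p.2 • (g p.1 - f p.1)‖ ≤ 1}
  have hM : IsCompact M := by
    refine IsCompact.image ?_ continuous_fst
    have := hf.continuous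
    have := hg.continuous
    have hc : Continuous fun p : (ι → ℝ) × ℝ => ‖f p.1 + p.2 • (g p.1 - f p.1)‖ := by fun_prop
    exact (hcW.prod isCompact_Icc).inter_right (isClosed_le hc continuous_const)
  have hMW : M ⊆ W := by
    rintro _ ⟨⟨x, t⟩, ⟨⟨hx, ht⟩, hle⟩, rfl⟩
    by_contra hxW
    exact (hfg x ⟨hx, by rwa [hW.interior_eq]⟩ t ht).not_ge hle
  obtain ⟨χ, L, hχ, hL, hLW, hχL, hχ1, hχI⟩ := exists_contDiff_cutoff hM hW hMW
  have hF : ContDiff ℝ 1 fun x => f x + χ x • (g x - f x) := hf.add (hχ.smul (hg.sub hf))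
  have hcd : ∀ {u : (ι → ℝ) → ι → ℝ}, ContDiff ℝ 1 u → ContDiff ℝ 1 (collapse ∘ u) := fun hu =>
    (contDiff_collapse (k := 1)).comp hu
  have h1 : smoothDeg f W = smoothDeg (fun x => f x + χ x • (g x - f x)) W := by
    have := setIntegral_det_fderiv_congr volume (hcd hf) (hcd hF) hW hWb hL.isClosed hLW
      fun x hx => by simp [hχL x hx]
    simpa only [smoothDeg, det_fderiv_collapse_comp hf, det_fderiv_collapse_comp hF] using this
  rw [h1]
  refine setIntegral_congr_fun hW.measurableSet fun x hx => ?_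
  by_cases hxM : x ∈ M
  · have : (fun y => f y + χ y • (g y - f y)) =ᶠ[𝓝 x] g := by
      filter_upwards [hχ1 x hxM] with y hy
      rw [hy, one_smul, add_sub_cancel]
    simp only [this.fderiv_eq, this.eq_of_nhds]
  · have hlt : ∀ t ∈ Icc (0 : ℝ) 1, 1 < ‖f x + t • (g x - f x)‖ := fun t ht => by
      by_contra h
      exact hxM ⟨⟨x, t⟩, ⟨⟨subset_closure hx, ht⟩, not_lt.1 h⟩, rfl⟩
    have h3 := hlt 1 (by simp)
    rw [one_smul, add_sub_cancel] at h3
    simp only [cubeBump_eq_zero (hlt _ (hχI x)), cubeBump_eq_zero h3, zero_mul]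

end SmoothDegree

section Integrality

open MeasureTheory Filter Topology

lemma IsCompact.exists_pos_forall_add_lt {X : Type*} [TopologicalSpace X] {K : Set X}
    (hK : IsCompact K) {u : X → ℝ} (hu : ContinuousOn u K) {c : ℝ} (h : ∀ x ∈ K, c < u x) :
    ∃ δ > 0, ∀ x ∈ K, c + δ < u x := by
  rcases K.eq_empty_or_nonempty with rfl | hne
  · exact ⟨1, one_pos, by simp⟩
  · obtain ⟨x, hx, hmin⟩ := hK.exists_isMinOn hne hu
    refine ⟨(u x - c) / 2, by linarith [h x hx], fun y hy => ?_⟩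
    have : u x ≤ u y := hmin hy
    linarith [h x hx]

variable {ι : Type*} [Fintype ι]

lemma smoothDeg_eq_sum {f : (ι → ℝ) → ι → ℝ} (hf : ContDiff ℝ 1 f) {W : Set (ι → ℝ)}
    (hW : IsOpen W) (hWb : Bornology.IsBounded W) {α : Type*} (s : Finset α)
    (V : α → Set (ι → ℝ)) (hVo : ∀ i ∈ s, IsOpen (V i)) (hVW : ∀ i ∈ s, V i ⊆ W)
    (hd : (s : Set α).PairwiseDisjoint V) (h : ∀ x ∈ W, (∀ i ∈ s, x ∉ V i) → 1 < ‖f x‖) :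
    smoothDeg f W = ∑ i ∈ s, smoothDeg f (V i) := by
  simp only [smoothDeg]
  rw [← integral_biUnion_finset s (fun i hi => (hVo i hi).measurableSet) hd fun i hi =>
    integrableOn_cubeBump_mul_det hf (hWb.subset (hVW i hi))]
  refine setIntegral_eq_of_subset_of_forall_sdiff_eq_zero hW.measurableSet
    (iUnion₂_subset hVW) fun x hx => ?_
  rw [cubeBump_eq_zero (h x hx.1 fun i hi hxi => hx.2 (mem_iUnion₂.2 ⟨i, hi, hxi⟩)), zero_mul]

lemma smoothDeg_of_injOn {f : (ι → ℝ) → ι → ℝ} (hf : ContDiff ℝ 1 f) {W : Set (ι → ℝ)}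
    (hW : IsOpen W) (hinj : InjOn f W) {sg : ℝ}
    (hsg : ∀ x ∈ W, (fderiv ℝ f x).det = sg * |(fderiv ℝ f x).det|)
    (hball : closedBall 0 1 ⊆ f '' W) : smoothDeg f W = sg := by
  have h1 := integral_image_eq_integral_abs_det_fderiv_smul volume hW.measurableSet
    (fun x _ => (hf.differentiable one_ne_zero x).hasFDerivAt.hasFDerivWithinAt) hinj
    (cubeBump (ι := ι))
  have h2 : ∫ y in f '' W, cubeBump y = 1 := by
    rw [← integral_cubeBump (ι := ι)]
    refine setIntegral_eq_integral_of_forall_compl_eq_zero fun y hy => cubeBump_eq_zero ?_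
    by_contra h
    exact hy (hball (mem_closedBall_zero_iff.2 (not_lt.1 h)))
  calc smoothDeg f W = ∫ x in W, sg * (|(fderiv ℝ f x).det| • cubeBump (f x)) := by
        refine setIntegral_congr_fun hW.measurableSet fun x hx => ?_
        simp only [smul_eq_mul]
        rw [← mul_assoc, ← hsg x hx, mul_comm]
    _ = sg := by rw [integral_const_mul, ← h1, h2, mul_one]

lemma exists_regular_value {f : (ι → ℝ) → ι → ℝ} (hf : ContDiff ℝ 1 f) {δ : ℝ} (hδ : 0 < δ) :
    ∃ y : ι → ℝ, ‖y‖ < δ ∧ ∀ x, f x = y → (fderiv ℝ f x).det ≠ 0 := by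
  have h0 := addHaar_image_eq_zero_of_det_fderivWithin_eq_zero (volume : Measure (ι → ℝ))
    (s := {x | (fderiv ℝ f x).det = 0}) (f := f)
    (fun x _ => (hf.differentiable one_ne_zero x).hasFDerivAt.hasFDerivWithinAt) (fun x hx => hx)
  have h1 : ¬ ball (0 : ι → ℝ) δ ⊆ f '' {x | (fderiv ℝ f x).det = 0} := fun h =>
    (measure_ball_pos volume (0 : ι → ℝ) hδ).ne' (measure_mono_null h h0)
  obtain ⟨y, hy, hyn⟩ := not_subset.1 h1
  exact ⟨y, mem_ball_zero_iff.1 hy, fun x hx hdet => hyn ⟨x, hdet, hx⟩⟩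

lemma exists_local_inverse_data {f : (ι → ℝ) → ι → ℝ} (hf : ContDiff ℝ 1 f) {W : Set (ι → ℝ)}
    (hW : IsOpen W) {x : ι → ℝ} (hx : x ∈ W) (hdet : (fderiv ℝ f x).det ≠ 0) :
    ∃ (O : Set (ι → ℝ)) (sg : ℤ), IsOpen O ∧ x ∈ O ∧ O ⊆ W ∧ InjOn f O ∧
      (∀ y ∈ O, (fderiv ℝ f y).det = sg * |(fderiv ℝ f y).det|) ∧
      ∀ O', IsOpen O' → x ∈ O' → f '' O' ∈ 𝓝 (f x) := by
  let A : (ι → ℝ) ≃L[ℝ] (ι → ℝ) :=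
    (fderiv ℝ f x).toContinuousLinearEquivOfDetNeZero hdet
  have hs : HasStrictFDerivAt f (A : (ι → ℝ) →L[ℝ] (ι → ℝ)) x := by
    have := (hf.contDiffAt (x := x)).hasStrictFDerivAt one_ne_zero
    simpa [A] using this
  have hcont : Continuous fun y => (fderiv ℝ f y).det :=
    ContinuousLinearMap.continuous_det.comp (hf.continuous_fderiv one_ne_zero)
  have hopen : ∀ O', IsOpen O' → x ∈ O' → f '' O' ∈ 𝓝 (f x) := fun O' hO' hxO' => by
    rw [← hs.map_nhds_eq_of_equiv]
    exact image_mem_map (hO'.mem_nhds hxO')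
  let e := hs.toOpenPartialHomeomorph f
  have hxe : x ∈ e.source := hs.mem_toOpenPartialHomeomorph_source
  rcases lt_or_gt_of_ne hdet with h | h
  · refine ⟨W ∩ e.source ∩ {y | (fderiv ℝ f y).det < 0}, -1,
      (hW.inter e.open_source).inter (isOpen_lt hcont continuous_const), ⟨⟨hx, hxe⟩, h⟩,
      fun y hy => hy.1.1, e.injOn.mono fun y hy => hy.1.2, fun y hy => ?_, hopen⟩
    rw [abs_of_neg hy.2]; simp
  · refine ⟨W ∩ e.source ∩ {y | 0 < (fderiv ℝ f y).det}, 1,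
      (hW.inter e.open_source).inter (isOpen_lt continuous_const hcont), ⟨⟨hx, hxe⟩, h⟩,
      fun y hy => hy.1.1, e.injOn.mono fun y hy => hy.1.2, fun y hy => ?_, hopen⟩
    rw [abs_of_pos hy.2]; simp

lemma exists_int_smoothDeg_eq_of_regular [Nonempty ι] {g : (ι → ℝ) → ι → ℝ}
    (hg : ContDiff ℝ 1 g) {W : Set (ι → ℝ)} (hW : IsOpen W) (hWb : Bornology.IsBounded W)
    (hfr : ∀ x ∈ frontier W, 1 < ‖g x‖) (hreg : ∀ x, g x = 0 → (fderiv ℝ g x).det ≠ 0) :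
    ∃ d : ℤ, smoothDeg g W = d := by
  classical
  have hcW : IsCompact (closure W) :=
    Metric.isCompact_of_isClosed_isBounded isClosed_closure hWb.closure
  set N : Set (ι → ℝ) := closure W ∩ {x | g x = 0}
  have hN : IsCompact N := hcW.inter_right (isClosed_eq hg.continuous continuous_const)
  have hNW : N ⊆ W := fun x hx => by
    by_contra hxW
    have := hfr x ⟨hx.1, by rwa [hW.interior_eq]⟩
    rw [show g x = 0 from hx.2, norm_zero] at this
    linarith
  have hdata : ∀ x ∈ N, ∃ (O : Set (ι → ℝ)) (sg : ℤ), IsOpen O ∧ x ∈ O ∧ O ⊆ W ∧ InjOn g O ∧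
      (∀ y ∈ O, (fderiv ℝ g y).det = sg * |(fderiv ℝ g y).det|) ∧
      ∀ O', IsOpen O' → x ∈ O' → g '' O' ∈ 𝓝 (g x) := fun x hx =>
    exists_local_inverse_data hg hW (hNW hx) (hreg x hx.2)
  choose! O sg hO hxO hOW hOi hOsg hOn using hdata
  have hfin : N.Finite := by
    obtain ⟨t, htN, hcov⟩ := hN.elim_nhds_subcover O fun x hx => (hO x hx).mem_nhds (hxO x hx)
    refine t.finite_toSet.subset fun x hx => ?_
    obtain ⟨z, hz, hxz⟩ := mem_iUnion₂.1 (hcov hx)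
    have : x = z := hOi z (htN z hz) hxz (hxO z (htN z hz))
      ((show g x = 0 from hx.2).trans (show g z = 0 from (htN z hz).2).symm)
    rwa [this]
  obtain ⟨S, hS, hSd⟩ := hfin.t2_separation
  let V : (ι → ℝ) → Set (ι → ℝ) := fun x => O x ∩ S x
  have hVo : ∀ x ∈ N, IsOpen (V x) := fun x hx => (hO x hx).inter (hS x).2
  have hxV : ∀ x ∈ N, x ∈ V x := fun x hx => ⟨hxO x hx, (hS x).1⟩
  have hC : IsCompact (closure W \ ⋃ x ∈ N, V x) :=
    hcW.diff (isOpen_biUnion hVo)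
  obtain ⟨δ, hδ, hδC⟩ := hC.exists_pos_forall_add_lt (c := 0) hg.continuous.norm.continuousOn
    fun x hx => by
      rw [norm_pos_iff]
      intro h0
      exact hx.2 (mem_iUnion₂.2 ⟨x, ⟨hx.1, h0⟩, hxV x ⟨hx.1, h0⟩⟩)
  have hball : ∃ ε > 0, ∀ x ∈ N, closedBall (0 : ι → ℝ) ε ⊆ g '' V x := by
    have : ∀ᶠ ε in 𝓝[>] (0 : ℝ), ∀ x ∈ N, closedBall (0 : ι → ℝ) ε ⊆ g '' V x := by
      rw [hfin.eventually_all]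
      intro x hx
      have h1 := hOn x hx (V x) (hVo x hx) (hxV x hx)
      rw [show g x = 0 from hx.2] at h1
      obtain ⟨r, hr, hrV⟩ := Metric.nhds_basis_closedBall.mem_iff.1 h1
      filter_upwards [Ioc_mem_nhdsGT hr] with ε hε
      exact (closedBall_subset_closedBall hε.2).trans hrV
    obtain ⟨ε, hε, hε0⟩ := (this.and self_mem_nhdsWithin).exists
    exact ⟨ε, hε0, hε⟩
  obtain ⟨ε, hε, hεV⟩ := hball
  set c : ℝ := 1 + 1 / δ + 1 / ε
  have hδ' : 0 < 1 / δ := by positivity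
  have hε' : 0 < 1 / ε := by positivity
  have hc0 : 0 < c := by positivity
  have hcg : ContDiff ℝ 1 fun x => c • g x := hg.const_smul c
  have hder : ∀ x, (fderiv ℝ (fun x => c • g x) x).det =
      c ^ Fintype.card ι * (fderiv ℝ g x).det := fun x => by
    rw [fderiv_fun_const_smul (hg.differentiable one_ne_zero x)]
    simp [ContinuousLinearMap.det]
  refine ⟨∑ x ∈ hfin.toFinset, sg x, ?_⟩
  have hcg1 : smoothDeg g W = smoothDeg (fun x => c • g x) W := by
    refine smoothDeg_eq_of_homotopy hg hcg hW hWb fun x hx t ht => ?_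
    have : g x + t • (c • g x - g x) = (1 + t * (c - 1)) • g x := by module
    have hc1 : 0 ≤ t * (c - 1) := mul_nonneg ht.1 (by simp only [c]; linarith)
    rw [this, norm_smul, Real.norm_of_nonneg (by linarith)]
    nlinarith [hfr x hx]
  rw [hcg1, smoothDeg_eq_sum hcg hW hWb hfin.toFinset V]
  · push_cast
    refine Finset.sum_congr rfl fun x hx => ?_
    have hx' : x ∈ N := hfin.mem_toFinset.1 hx
    refine smoothDeg_of_injOn hcg (hVo x hx') ?_ ?_ ?_
    · intro y hy z hz hyz
      exact hOi x hx' hy.1 hz.1 (smul_right_injective _ hc0.ne' hyz)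
    · intro y hy
      rw [hder, abs_mul, abs_of_pos (pow_pos hc0 _), mul_left_comm, ← hOsg x hx' y hy.1]
    · intro y hy
      have : c⁻¹ • y ∈ closedBall (0 : ι → ℝ) ε := by
        rw [mem_closedBall_zero_iff] at hy ⊢
        rw [norm_smul, norm_inv, Real.norm_of_nonneg hc0.le, inv_mul_le_iff₀ hc0]
        have : 1 ≤ c * ε := by
          simp only [c]
          rw [add_mul, one_div_mul_cancel hε.ne']
          have : 0 ≤ (1 + 1 / δ) * ε := by positivity
          linarith
        linarith
      obtain ⟨z, hz, hzy⟩ := hεV x hx' this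
      exact ⟨z, hz, by simp only [hzy]; rw [smul_inv_smul₀ hc0.ne']⟩
  · exact fun x hx => hVo x (hfin.mem_toFinset.1 hx)
  · exact fun x hx => inter_subset_left.trans (hOW x (hfin.mem_toFinset.1 hx))
  · intro x hx y hy hxy
    exact (hSd (hfin.mem_toFinset.1 hx) (hfin.mem_toFinset.1 hy) hxy).mono
      inter_subset_right inter_subset_right
  · intro x hx hxV'
    have h1 := hδC x ⟨subset_closure hx, fun h => by
      obtain ⟨z, hz, hxz⟩ := mem_iUnion₂.1 h
      exact hxV' z (hfin.mem_toFinset.2 hz) hxz⟩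
    rw [norm_smul, Real.norm_of_nonneg hc0.le]
    have : 1 ≤ c * δ := by
      have h2 : c * δ = 1 + (1 + 1 / ε) * δ := by
        simp only [c]; field_simp; ring
      have : 0 ≤ (1 + 1 / ε) * δ := by positivity
      linarith
    nlinarith

lemma exists_int_smoothDeg_eq [Nonempty ι] {f : (ι → ℝ) → ι → ℝ} (hf : ContDiff ℝ 1 f)
    {W : Set (ι → ℝ)} (hW : IsOpen W) (hWb : Bornology.IsBounded W)
    (hfr : ∀ x ∈ frontier W, 1 < ‖f x‖) : ∃ d : ℤ, smoothDeg f W = d := by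
  have hK : IsCompact (frontier W) := (Metric.isCompact_of_isClosed_isBounded isClosed_closure
    hWb.closure).of_isClosed_subset isClosed_frontier frontier_subset_closure
  obtain ⟨δ, hδ, h⟩ := hK.exists_pos_forall_add_lt hf.continuous.norm.continuousOn hfr
  obtain ⟨y, hy, hreg⟩ := exists_regular_value hf hδ
  have hg : ContDiff ℝ 1 fun x => f x - y := hf.sub contDiff_const
  have hn : ∀ x ∈ frontier W, ∀ t ∈ Icc (0 : ℝ) 1, 1 < ‖f x - t • y‖ := fun x hx t ht => by
    have h1 := norm_sub_norm_le (f x) (t • y)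
    rw [norm_smul, Real.norm_of_nonneg ht.1] at h1
    nlinarith [h x hx, norm_nonneg y, ht.2]
  rw [smoothDeg_eq_of_homotopy hf hg hW hWb fun x hx t ht => by
    simpa [sub_eq_add_neg] using hn x hx t ht]
  refine exists_int_smoothDeg_eq_of_regular hg hW hWb
    (fun x hx => by simpa using hn x hx 1 (by simp)) fun x hx => ?_
  rw [fderiv_sub_const]
  exact hreg x (sub_eq_zero.1 hx)

end Integrality

section Degree

open MeasureTheory Filter Topology

variable {ι : Type*} [Fintype ι]

/-- `g` is a `C¹` map close enough to a multiple of `u` on the frontier of `W` to compute the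
degree of `u` at `0` on `W`. -/
def IsSmoothing (u : (ι → ℝ) → ι → ℝ) (W : Set (ι → ℝ)) (g : (ι → ℝ) → ι → ℝ) : Prop :=
  ContDiff ℝ 1 g ∧ ∃ c : ℝ, 0 < c ∧ ∀ x ∈ frontier W, ‖g x - c • u x‖ + 1 < c * ‖u x‖

lemma IsSmoothing.one_lt_norm {u g : (ι → ℝ) → ι → ℝ} {W : Set (ι → ℝ)} (hg : IsSmoothing u W g)
    {x : ι → ℝ} (hx : x ∈ frontier W) : 1 < ‖g x‖ := by
  obtain ⟨-, c, hc, h⟩ := hg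
  have h1 := h x hx
  have h2 := norm_sub_norm_le (c • u x) (c • u x - g x)
  rw [sub_sub_cancel, norm_smul, Real.norm_of_nonneg hc.le, norm_sub_rev] at h2
  linarith

lemma IsSmoothing.smoothDeg_eq [Nonempty ι] {u g g' : (ι → ℝ) → ι → ℝ} {W : Set (ι → ℝ)}
    (hg : IsSmoothing u W g) (hg' : IsSmoothing u W g') (hW : IsOpen W)
    (hWb : Bornology.IsBounded W) : smoothDeg g W = smoothDeg g' W := by
  obtain ⟨hgs, c, hc, h⟩ := hg
  obtain ⟨hgs', c', hc', h'⟩ := hg'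
  refine smoothDeg_eq_of_homotopy hgs hgs' hW hWb fun x hx t ht => ?_
  have h1 := h x hx
  have h1' := h' x hx
  have hc2 : 0 ≤ c + t * (c' - c) := by nlinarith [ht.1, ht.2]
  have h2 := norm_sub_norm_le ((c + t * (c' - c)) • u x)
    ((c + t * (c' - c)) • u x - (g x + t • (g' x - g x)))
  rw [sub_sub_cancel, norm_smul, Real.norm_of_nonneg hc2] at h2
  have h3 : (c + t * (c' - c)) • u x - (g x + t • (g' x - g x)) =
      -((1 - t) • (g x - c • u x) + t • (g' x - c' • u x)) := by module
  have h4 := norm_add_le ((1 - t) • (g x - c • u x)) (t • (g' x - c' • u x))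
  rw [norm_smul, norm_smul, Real.norm_of_nonneg ht.1,
    Real.norm_of_nonneg (sub_nonneg.2 ht.2)] at h4
  rw [h3, norm_neg] at h2
  rcases ht.1.eq_or_lt with rfl | h0
  · simp only [zero_mul, one_mul, sub_zero, add_zero] at *
    linarith
  · nlinarith [mul_lt_mul_of_pos_left h1' h0, mul_le_mul_of_nonneg_left h1.le (sub_nonneg.2 ht.2)]

open Classical in
/-- The Brouwer degree at `0` on `W` of a continuous map `u` not vanishing on the frontier of the
bounded open set `W`. -/
def deg (u : (ι → ℝ) → ι → ℝ) (W : Set (ι → ℝ)) : ℤ :=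
  if h : ∃ d : ℤ, ∃ g, IsSmoothing u W g ∧ smoothDeg g W = d then h.choose else 0

lemma IsSmoothing.deg_eq [Nonempty ι] {u g : (ι → ℝ) → ι → ℝ} {W : Set (ι → ℝ)}
    (hg : IsSmoothing u W g) (hW : IsOpen W) (hWb : Bornology.IsBounded W) :
    (deg u W : ℝ) = smoothDeg g W := by
  have h : ∃ d : ℤ, ∃ g, IsSmoothing u W g ∧ smoothDeg g W = d := by
    obtain ⟨d, hd⟩ := exists_int_smoothDeg_eq hg.1 hW hWb fun x hx => hg.one_lt_norm hx
    exact ⟨d, g, hg, hd⟩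
  obtain ⟨g', hg', hd⟩ := h.choose_spec
  rw [deg, dif_pos h, ← hd]
  exact hg'.smoothDeg_eq hg hW hWb

lemma exists_contDiff_norm_sub_smul_lt {u : (ι → ℝ) → ι → ℝ} (hu : Continuous u) (c : ℝ) {ε : ℝ}
    (hε : 0 < ε) : ∃ g : (ι → ℝ) → ι → ℝ, ContDiff ℝ 1 g ∧ ∀ x, ‖g x - c • u x‖ < ε := by
  obtain ⟨g, hg, h, -⟩ := (hu.const_smul c).exists_contDiff_approx 1 (ε := fun _ => ε)
    continuous_const fun _ => hε
  exact ⟨g, hg, fun x => by simpa [dist_eq_norm] using h x⟩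

lemma Bornology.IsBounded.isCompact_frontier {X : Type*} [PseudoMetricSpace X] [ProperSpace X]
    {W : Set X} (hWb : Bornology.IsBounded W) : IsCompact (frontier W) :=
  (Metric.isCompact_of_isClosed_isBounded isClosed_closure
    hWb.closure).of_isClosed_subset isClosed_frontier frontier_subset_closure

lemma deg_eq_of_homotopy [Nonempty ι] {u v : (ι → ℝ) → ι → ℝ} (hu : Continuous u)
    (hv : Continuous v) {W : Set (ι → ℝ)} (hW : IsOpen W) (hWb : Bornology.IsBounded W)
    (h : ∀ x ∈ frontier W, ∀ t ∈ Icc (0 : ℝ) 1, u x + t • (v x - u x) ≠ 0) :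
    deg u W = deg v W := by
  have hK : IsCompact (frontier W ×ˢ Icc (0 : ℝ) 1) := hWb.isCompact_frontier.prod isCompact_Icc
  obtain ⟨η, hη, hn⟩ := hK.exists_pos_forall_add_lt (c := 0)
    (u := fun p => ‖u p.1 + p.2 • (v p.1 - u p.1)‖) (by fun_prop)
    fun p hp => norm_pos_iff.2 (h p.1 hp.1 p.2 hp.2)
  have hc : 0 < 2 / η := by positivity
  have hn' : ∀ x ∈ frontier W, ∀ t ∈ Icc (0 : ℝ) 1, 2 < 2 / η * ‖u x + t • (v x - u x)‖ :=
    fun x hx t ht => by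
      have := hn (x, t) ⟨hx, ht⟩
      rw [zero_add] at this
      calc 2 = 2 / η * η := by field_simp
        _ < _ := mul_lt_mul_of_pos_left this hc
  obtain ⟨g, hg, hgu⟩ := exists_contDiff_norm_sub_smul_lt hu (2 / η) one_pos
  obtain ⟨g', hg', hgv⟩ := exists_contDiff_norm_sub_smul_lt hv (2 / η) one_pos
  have hs : IsSmoothing u W g := ⟨hg, 2 / η, hc, fun x hx => by
    have h1 := hn' x hx 0 (by simp)
    rw [zero_smul, add_zero] at h1
    linarith [hgu x]⟩
  have hs' : IsSmoothing v W g' := ⟨hg', 2 / η, hc, fun x hx => by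
    have h1 := hn' x hx 1 (by simp)
    rw [one_smul, add_sub_cancel] at h1
    linarith [hgv x]⟩
  have := smoothDeg_eq_of_homotopy hg hg' hW hWb fun x hx t ht => by
    have h1 := hn' x hx t ht
    have h2 := norm_sub_norm_le ((2 / η) • (u x + t • (v x - u x)))
      ((2 / η) • (u x + t • (v x - u x)) - (g x + t • (g' x - g x)))
    rw [sub_sub_cancel, norm_smul, Real.norm_of_nonneg hc.le] at h2
    have h3 : (2 / η) • (u x + t • (v x - u x)) - (g x + t • (g' x - g x)) =
      -((1 - t) • (g x - (2 / η) • u x) + t • (g' x - (2 / η) • v x)) := by module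
    have h4 := norm_add_le ((1 - t) • (g x - (2 / η) • u x)) (t • (g' x - (2 / η) • v x))
    rw [norm_smul, norm_smul, Real.norm_of_nonneg ht.1,
      Real.norm_of_nonneg (sub_nonneg.2 ht.2)] at h4
    rw [h3, norm_neg] at h2
    nlinarith [mul_le_mul_of_nonneg_left (hgu x).le (sub_nonneg.2 ht.2),
      mul_le_mul_of_nonneg_left (hgv x).le ht.1]
  exact_mod_cast (hs.deg_eq hW hWb).trans (this.trans (hs'.deg_eq hW hWb).symm)

lemma deg_congr [Nonempty ι] {u v : (ι → ℝ) → ι → ℝ} (hu : Continuous u)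
    (hv : Continuous v) {W : Set (ι → ℝ)} (hW : IsOpen W) (hWb : Bornology.IsBounded W)
    (h : ∀ x ∈ frontier W, u x = v x) (h0 : ∀ x ∈ frontier W, u x ≠ 0) : deg u W = deg v W :=
  deg_eq_of_homotopy hu hv hW hWb fun x hx t _ => by simpa [← h x hx] using h0 x hx

lemma deg_eq_sum [Nonempty ι] {u : (ι → ℝ) → ι → ℝ} (hu : Continuous u) {W : Set (ι → ℝ)}
    (hW : IsOpen W) (hWb : Bornology.IsBounded W) {α : Type*} (s : Finset α)
    (V : α → Set (ι → ℝ)) (hVo : ∀ i ∈ s, IsOpen (V i)) (hVW : ∀ i ∈ s, V i ⊆ W)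
    (hd : (s : Set α).PairwiseDisjoint V)
    (h : ∀ x ∈ closure W, (∀ i ∈ s, x ∉ V i) → u x ≠ 0) :
    deg u W = ∑ i ∈ s, deg u (V i) := by
  have hK : IsCompact (closure W \ ⋃ i ∈ s, V i) :=
    (Metric.isCompact_of_isClosed_isBounded isClosed_closure hWb.closure).diff
      (isOpen_biUnion hVo)
  obtain ⟨η, hη, hn⟩ := hK.exists_pos_forall_add_lt (c := 0) (u := fun x => ‖u x‖)
    hu.norm.continuousOn fun x hx => norm_pos_iff.2 (h x hx.1 fun i hi hxi =>
      hx.2 (mem_iUnion₂.2 ⟨i, hi, hxi⟩))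
  have hc : 0 < 2 / η := by positivity
  have hn' : ∀ x ∈ closure W, (∀ i ∈ s, x ∉ V i) → 2 < 2 / η * ‖u x‖ := fun x hx hxi => by
    have := hn x ⟨hx, by simpa using hxi⟩
    rw [zero_add] at this
    calc 2 = 2 / η * η := by field_simp
      _ < _ := mul_lt_mul_of_pos_left this hc
  obtain ⟨g, hg, hgu⟩ := exists_contDiff_norm_sub_smul_lt hu (2 / η) one_pos
  have hs : IsSmoothing u W g := ⟨hg, 2 / η, hc, fun x hx => by
    have h1 := hn' x (frontier_subset_closure hx) fun i hi hxi =>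
      (hW.frontier_eq ▸ hx).2 (hVW i hi hxi)
    linarith [hgu x]⟩
  have hs' : ∀ i ∈ s, IsSmoothing u (V i) g := fun i hi => ⟨hg, 2 / η, hc, fun x hx => by
    have h1 := hn' x (closure_mono (hVW i hi) (frontier_subset_closure hx)) fun j hj hxj => by
      by_cases hij : j = i
      · subst hij
        exact ((hVo j hj).frontier_eq ▸ hx).2 hxj
      · have hdj := hd hj hi hij
        exact ((hdj.closure_right (hVo j hj)).le_bot
          ⟨hxj, frontier_subset_closure hx⟩ : x ∈ (∅ : Set _))
    linarith [hgu x]⟩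
  have h1 := smoothDeg_eq_sum hg hW hWb s V hVo hVW hd fun x hx hxi => by
    have h1 := hn' x (subset_closure hx) hxi
    have h2 := norm_sub_norm_le ((2 / η) • u x) ((2 / η) • u x - g x)
    rw [sub_sub_cancel, norm_smul, Real.norm_of_nonneg hc.le, norm_sub_rev] at h2
    linarith [hgu x]
  rw [← hs.deg_eq hW hWb, Finset.sum_congr rfl fun i hi =>
    ((hs' i hi).deg_eq (hVo i hi) (hWb.subset (hVW i hi))).symm] at h1
  exact_mod_cast h1

lemma deg_eq_zero [Nonempty ι] {u : (ι → ℝ) → ι → ℝ} (hu : Continuous u) {W : Set (ι → ℝ)}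
    (hW : IsOpen W) (hWb : Bornology.IsBounded W) (h : ∀ x ∈ closure W, u x ≠ 0) :
    deg u W = 0 := by
  simpa using deg_eq_sum hu hW hWb (∅ : Finset ℕ) (fun _ => ∅) (by simp) (by simp) (by simp)
    fun x hx _ => h x hx

lemma deg_eq_of_subset [Nonempty ι] {u : (ι → ℝ) → ι → ℝ} (hu : Continuous u) {V W : Set (ι → ℝ)}
    (hW : IsOpen W) (hWb : Bornology.IsBounded W) (hV : IsOpen V) (hVW : V ⊆ W)
    (h : ∀ x ∈ closure W, x ∉ V → u x ≠ 0) : deg u W = deg u V := by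
  simpa using deg_eq_sum hu hW hWb ({0} : Finset ℕ) (fun _ => V) (by simpa) (by simpa) (by simp)
    fun x hx hxV => h x hx (by simpa using hxV)

lemma deg_sub_const_self [Nonempty ι] {W : Set (ι → ℝ)} (hW : IsOpen W)
    (hWb : Bornology.IsBounded W) {y : ι → ℝ} (hy : y ∈ W) : deg (fun x => x - y) W = 1 := by
  obtain ⟨ε, hε, hball⟩ := Metric.isOpen_iff.1 hW y hy
  have hc : 0 < 2 / ε := by positivity
  have hcd : ∀ x : ι → ℝ, HasFDerivAt (fun x => (2 / ε) • (x - y))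
      ((2 / ε) • ContinuousLinearMap.id ℝ (ι → ℝ)) x := fun x =>
    ((hasFDerivAt_id x).sub_const y).const_smul (2 / ε)
  have hg : ContDiff ℝ 1 fun x : ι → ℝ => (2 / ε) • (x - y) :=
    (contDiff_id.sub contDiff_const).const_smul _
  have hs : IsSmoothing (fun x => x - y) W (fun x => (2 / ε) • (x - y)) :=
    ⟨hg, 2 / ε, hc, fun x hx => by
      have h1 : ε ≤ ‖x - y‖ := by
        by_contra! hlt
        exact (hW.frontier_eq ▸ hx).2 (hball (by rwa [mem_ball, dist_eq_norm]))
      rw [sub_self, norm_zero, zero_add]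
      calc (1 : ℝ) < 2 / ε * ε := by field_simp; norm_num
        _ ≤ _ := mul_le_mul_of_nonneg_left h1 hc.le⟩
  have h1 : smoothDeg (fun x => (2 / ε) • (x - y)) W = 1 := by
    refine smoothDeg_of_injOn hg hW (fun a _ b _ hab => ?_) (fun x _ => ?_) fun z hz => ?_
    · simpa [hc.ne'] using hab
    · rw [(hcd x).fderiv, one_mul, abs_of_nonneg]
      simp only [ContinuousLinearMap.det, ContinuousLinearMap.toLinearMap_smul,
        ContinuousLinearMap.coe_id, LinearMap.det_smul, LinearMap.det_id]
      positivity
    · refine ⟨y + (ε / 2) • z, hball ?_, ?_⟩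
      · rw [mem_closedBall_zero_iff] at hz
        rw [mem_ball, dist_eq_norm, add_sub_cancel_left, norm_smul,
          Real.norm_of_nonneg (by positivity)]
        nlinarith
      · simp only [add_sub_cancel_left, smul_smul]
        rw [show 2 / ε * (ε / 2) = 1 by field_simp, one_smul]
  exact_mod_cast (hs.deg_eq hW hWb).trans h1

end Degree

section Mollifier

open MeasureTheory Filter Topology

variable {ι : Type*} [Fintype ι]

lemma integral_cubeBump_scaled {c : ℝ} (hc : 0 < c) (a : ι → ℝ) :
    ∫ y : ι → ℝ, c ^ Fintype.card ι * cubeBump (c • (a - y)) = 1 := by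
  rw [integral_const_mul, integral_sub_left_eq_self (fun y => cubeBump (c • y)) volume a,
    Measure.integral_comp_smul, integral_cubeBump]
  simp [abs_of_pos hc, hc.ne']

lemma smoothDeg_smul_sub {f : (ι → ℝ) → ι → ℝ} (hf : ContDiff ℝ 1 f) (W : Set (ι → ℝ)) (c : ℝ)
    (y : ι → ℝ) : smoothDeg (fun x => c • (f x - y)) W =
      ∫ x in W, c ^ Fintype.card ι * cubeBump (c • (f x - y)) * (fderiv ℝ f x).det := by
  refine integral_congr_ae (Eventually.of_forall fun x => ?_)
  have h : HasFDerivAt (fun x => c • (f x - y)) (c • fderiv ℝ f x) x :=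
    ((hf.differentiable one_ne_zero x).hasFDerivAt.sub_const y).const_smul c
  simp only [h.fderiv, ContinuousLinearMap.det, ContinuousLinearMap.toLinearMap_smul,
    LinearMap.det_smul, Module.finrank_fintype_fun_eq_card]
  ring

lemma abs_setIntegral_cubeBump_mul_sub_le {c η : ℝ} (hc : 0 < c) {ρ : (ι → ℝ) → ℝ}
    (hρ : Continuous ρ) {B : Set (ι → ℝ)} {a : ι → ℝ}
    (hB : ∀ y, ‖y - a‖ ≤ c⁻¹ → y ∈ B) (h : ∀ y, ‖y - a‖ ≤ c⁻¹ → |ρ y - ρ a| ≤ η) :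
    |(∫ y in B, c ^ Fintype.card ι * cubeBump (c • (a - y)) * ρ y) - ρ a| ≤ η := by
  have h0 : ∀ y, c⁻¹ < ‖y - a‖ → cubeBump (c • (a - y)) = 0 := fun y hy => cubeBump_eq_zero (by
    rw [norm_smul, Real.norm_of_nonneg hc.le, norm_sub_rev]
    calc 1 = c * c⁻¹ := by field_simp
      _ < _ := mul_lt_mul_of_pos_left hy hc)
  have hcs : HasCompactSupport fun y => c ^ Fintype.card ι * cubeBump (c • (a - y)) :=
    HasCompactSupport.intro (isCompact_closedBall a c⁻¹) fun y hy => by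
      rw [h0 y (by simpa [dist_eq_norm] using hy), mul_zero]
  have hcont : Continuous fun y => c ^ Fintype.card ι * cubeBump (c • (a - y)) := by
    have := continuous_cubeBump (ι := ι)
    fun_prop
  have hi1 : Integrable fun y => c ^ Fintype.card ι * cubeBump (c • (a - y)) :=
    hcont.integrable_of_hasCompactSupport hcs
  have hi2 : Integrable fun y => c ^ Fintype.card ι * cubeBump (c • (a - y)) * ρ y :=
    (hcont.mul hρ).integrable_of_hasCompactSupport hcs.mul_right
  rw [setIntegral_eq_integral_of_forall_compl_eq_zero fun y hy => by
    rw [h0 y (not_le.1 fun h => hy (hB y h)), mul_zero, zero_mul]]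
  have h1 : ρ a = ∫ y, c ^ Fintype.card ι * cubeBump (c • (a - y)) * ρ a := by
    rw [integral_mul_const, integral_cubeBump_scaled hc, one_mul]
  have h2 : η = ∫ y, c ^ Fintype.card ι * cubeBump (c • (a - y)) * η := by
    rw [integral_mul_const, integral_cubeBump_scaled hc, one_mul]
  rw [h1, ← integral_sub hi2 (hi1.mul_const _), h2, ← Real.norm_eq_abs]
  refine norm_integral_le_of_norm_le (hi1.mul_const _) (Eventually.of_forall fun y => ?_)
  rw [← mul_sub, Real.norm_eq_abs, abs_mul, abs_of_nonneg
    (mul_nonneg (pow_nonneg hc.le _) (cubeBump_nonneg _))]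
  rcases le_or_gt ‖y - a‖ c⁻¹ with hy | hy
  · exact mul_le_mul_of_nonneg_left (h y hy) (mul_nonneg (pow_nonneg hc.le _) (cubeBump_nonneg _))
  · simp [h0 y hy]

lemma setIntegral_comp_mul_det {f : (ι → ℝ) → ι → ℝ} (hf : ContDiff ℝ 1 f) {W V : Set (ι → ℝ)}
    (hW : IsOpen W) (hWb : Bornology.IsBounded W) (hV : MeasurableSet V) (hVb : Bornology.IsBounded V)
    {ρ : (ι → ℝ) → ℝ} (hρ : Continuous ρ) {d ε₀ : ℝ} (hε₀ : 0 < ε₀)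
    (h : ∀ y, ρ y ≠ 0 → ∀ ε, 0 < ε → ε ≤ ε₀ →
      smoothDeg (fun x => ε⁻¹ • (f x - y)) W = V.indicator (fun _ => d) y) :
    ∫ x in W, ρ (f x) * (fderiv ℝ f x).det = d * ∫ y in V, ρ y := by
  have hcW : IsCompact (closure W) :=
    Metric.isCompact_of_isClosed_isBounded isClosed_closure hWb.closure
  have hJ : Continuous fun x => (fderiv ℝ f x).det :=
    ContinuousLinearMap.continuous_det.comp (hf.continuous_fderiv one_ne_zero)
  obtain ⟨R, hR⟩ := ((hcW.image hf.continuous).isBounded.union hVb).subset_closedBall 0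
  set B : Set (ι → ℝ) := closedBall 0 (R + 1)
  have hVB : V ⊆ B := (subset_union_right.trans hR).trans (closedBall_subset_closedBall (by simp))
  have hfB : ∀ x ∈ W, ∀ y, ‖y - f x‖ ≤ 1 → y ∈ B := fun x hx y hy => by
    have h1 := hR (Or.inl (mem_image_of_mem f (subset_closure hx)))
    rw [mem_closedBall_zero_iff] at h1 ⊢
    linarith [norm_le_norm_add_norm_sub (f x) y, norm_sub_rev y (f x)]
  have hJi : IntegrableOn (fun x => |(fderiv ℝ f x).det|) W :=
    (hJ.abs.continuousOn.integrableOn_compact hcW).mono_set subset_closure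
  have hρi : IntegrableOn (fun x => ρ (f x) * (fderiv ℝ f x).det) W :=
    (((hρ.comp hf.continuous).mul hJ).continuousOn.integrableOn_compact hcW).mono_set
      subset_closure
  have key : ∀ η > 0, |(∫ x in W, ρ (f x) * (fderiv ℝ f x).det) - d * ∫ y in V, ρ y| ≤
      η * ∫ x in W, |(fderiv ℝ f x).det| := fun η hη => by
    obtain ⟨δ, hδ, hδρ⟩ := Metric.uniformContinuousOn_iff_le.1
      ((isCompact_closedBall (0 : ι → ℝ) (R + 1)).uniformContinuousOn_of_continuous
        hρ.continuousOn) η hη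
    set ε := min ε₀ (min δ 1)
    have hε : 0 < ε := by positivity
    have hc : 0 < ε⁻¹ := by positivity
    set φ : (ι → ℝ) → ℝ := fun y => ε⁻¹ ^ Fintype.card ι * cubeBump (ε⁻¹ • y)
    have hφ : Continuous φ := by
      have := continuous_cubeBump (ι := ι)
      fun_prop
    have hint : Integrable (Function.uncurry fun (x y : ι → ℝ) =>
        φ (f x - y) * ρ y * (fderiv ℝ f x).det)
        ((volume.restrict W).prod (volume.restrict B)) := by
      rw [Measure.prod_restrict]
      have hcont : Continuous (Function.uncurry fun (x y : ι → ℝ) =>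
          φ (f x - y) * ρ y * (fderiv ℝ f x).det) := by
        have := hf.continuous
        exact ((hφ.comp (by fun_prop)).mul (hρ.comp continuous_snd)).mul (hJ.comp continuous_fst)
      exact (hcont.continuousOn.integrableOn_compact (hcW.prod (isCompact_closedBall 0 _))).mono_set
        (prod_mono subset_closure Subset.rfl)
    have h1 : ∫ y in B, ∫ x in W, φ (f x - y) * ρ y * (fderiv ℝ f x).det =
        d * ∫ y in V, ρ y := by
      rw [← integral_const_mul, ← integral_indicator hV,
        ← setIntegral_eq_integral_of_forall_compl_eq_zero (s := B) fun y hy =>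
          indicator_of_notMem (fun hyV => hy (hVB hyV)) _]
      refine integral_congr_ae (Eventually.of_forall fun y => ?_)
      have h2 : ∫ x in W, φ (f x - y) * ρ y * (fderiv ℝ f x).det =
          ρ y * smoothDeg (fun x => ε⁻¹ • (f x - y)) W := by
        rw [smoothDeg_smul_sub hf, ← integral_const_mul]
        exact integral_congr_ae (Eventually.of_forall fun x => by simp only [φ]; ring)
      simp only [h2]
      by_cases hy : ρ y = 0
      · by_cases hyV : y ∈ V <;> simp [hy, hyV]
      · rw [h y hy ε hε (min_le_left _ _)]
        by_cases hyV : y ∈ V <;> simp [hyV, mul_comm]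
    have h3 : ∀ x ∈ W, |(∫ y in B, φ (f x - y) * ρ y) - ρ (f x)| ≤ η := fun x hx => by
      have hsub : ∀ y, ‖y - f x‖ ≤ ε⁻¹⁻¹ → ‖y - f x‖ ≤ δ ∧ ‖y - f x‖ ≤ 1 := fun y hy => by
        rw [inv_inv] at hy
        have h4 := hy.trans (min_le_right _ _)
        exact ⟨h4.trans (min_le_left _ _), h4.trans (min_le_right _ _)⟩
      refine abs_setIntegral_cubeBump_mul_sub_le hc hρ (fun y hy => hfB x hx y (hsub y hy).2)
        fun y hy => ?_
      rw [← Real.dist_eq]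
      exact hδρ y (hfB x hx y (hsub y hy).2) (f x) (hfB x hx _ (by simp))
        (by rw [dist_eq_norm]; exact (hsub y hy).1)
    have hleft : Integrable (fun x => ∫ y in B, φ (f x - y) * ρ y * (fderiv ℝ f x).det)
        (volume.restrict W) := hint.integral_prod_left
    rw [← h1, ← integral_integral_swap hint, ← integral_sub hρi hleft,
      ← integral_const_mul, ← Real.norm_eq_abs]
    refine norm_integral_le_of_norm_le (hJi.const_mul η)
      ((ae_restrict_iff' hW.measurableSet).2 (Eventually.of_forall fun x hx => ?_))
    rw [integral_mul_const, ← sub_mul, Real.norm_eq_abs, abs_mul, abs_sub_comm]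
    exact mul_le_mul_of_nonneg_right (h3 x hx) (abs_nonneg _)
  rw [← sub_eq_zero, ← abs_nonpos_iff]
  have h0 : 0 ≤ ∫ x in W, |(fderiv ℝ f x).det| := integral_nonneg fun x => abs_nonneg _
  refine le_of_forall_pos_le_add fun η hη => ?_
  refine (key (η / (1 + ∫ x in W, |(fderiv ℝ f x).det|)) (by positivity)).trans ?_
  rw [zero_add, div_mul_eq_mul_div, div_le_iff₀ (by positivity)]
  nlinarith

/-- The product formula for degrees, when the degree of `f` on `W` is `d` on `V` and `0` outside. -/
lemma deg_comp_sub_const [Nonempty ι] {f k : (ι → ℝ) → ι → ℝ} (hf : Continuous f)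
    (hk : Continuous k) {W V K : Set (ι → ℝ)} (hW : IsOpen W) (hWb : Bornology.IsBounded W)
    (hV : IsOpen V) (hVb : Bornology.IsBounded V) (hK : IsCompact K)
    (hfK : ∀ x ∈ frontier W, f x ∈ K) (hVK : frontier V ⊆ K) {z : ι → ℝ}
    (hz : ∀ y ∈ K, k y ≠ z) {d : ℤ} (h1 : ∀ y ∈ V, y ∉ K → deg (fun x => f x - y) W = d)
    (h0 : ∀ y ∉ V, y ∉ K → deg (fun x => f x - y) W = 0) :
    deg (fun x => k (f x) - z) W = deg (fun y => k y - z) V * d := by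
  obtain ⟨η, hη, hn⟩ := hK.exists_pos_forall_add_lt (c := 0) (u := fun y => ‖k y - z‖)
    (by fun_prop) fun y hy => norm_pos_iff.2 (sub_ne_zero.2 (hz y hy))
  have hc : 0 < 3 / η := by positivity
  have hn' : ∀ y ∈ K, 3 < 3 / η * ‖k y - z‖ := fun y hy => by
    have := hn y hy
    rw [zero_add] at this
    calc 3 = 3 / η * η := by field_simp
      _ < _ := mul_lt_mul_of_pos_left this hc
  obtain ⟨k₁, hk₁, hkk⟩ := exists_contDiff_norm_sub_smul_lt
    (show Continuous fun y => k y - z from hk.sub continuous_const) (3 / η) one_pos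
  have hs : IsSmoothing (fun y => k y - z) V k₁ := ⟨hk₁, 3 / η, hc, fun y hy => by
    beta_reduce
    linarith [hkk y, hn' y (hVK hy)]⟩
  obtain ⟨δ, hδ, hthick⟩ := hK.exists_thickening_subset_open
    (isOpen_lt continuous_const hk₁.continuous.norm) (show K ⊆ {y | 1 < ‖k₁ y‖} from fun y hy => by
      have h2 := norm_sub_norm_le ((3 / η) • (k y - z)) ((3 / η) • (k y - z) - k₁ y)
      rw [sub_sub_cancel, norm_smul, Real.norm_of_nonneg hc.le,
        norm_sub_rev ((3 / η) • (k y - z))] at h2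
      show 1 < ‖k₁ y‖
      linarith [hkk y, hn' y hy])
  obtain ⟨δ', hδ', hclose⟩ := Metric.mem_uniformity_dist.1
    ((hWb.isCompact_frontier.image hf).uniformContinuousAt_of_continuousAt k₁
      (fun y _ => hk₁.continuous.continuousAt) (Metric.dist_mem_uniformity one_pos))
  obtain ⟨f₁, hf₁, hff⟩ := exists_contDiff_norm_sub_smul_lt hf 1
    (show 0 < min (δ / 2) δ' by positivity)
  simp only [one_smul] at hff
  have hsc : IsSmoothing (fun x => k (f x) - z) W (k₁ ∘ f₁) := ⟨hk₁.comp hf₁, 3 / η, hc,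
    fun x hx => by
      have h2 : dist (k₁ (f x)) (k₁ (f₁ x)) < 1 := hclose (by
        rw [dist_comm, dist_eq_norm]
        exact (hff x).trans_le (min_le_right _ _)) (mem_image_of_mem f hx)
      rw [dist_comm, dist_eq_norm] at h2
      have h3 := norm_add_le (k₁ (f₁ x) - k₁ (f x)) (k₁ (f x) - (3 / η) • (k (f x) - z))
      rw [sub_add_sub_cancel] at h3
      simp only [Function.comp_apply]
      linarith [hkk (f x), hn' _ (hfK x hx)]⟩
  have hcomp : smoothDeg (k₁ ∘ f₁) W =
      ∫ x in W, cubeBump (k₁ (f₁ x)) * (fderiv ℝ k₁ (f₁ x)).det * (fderiv ℝ f₁ x).det := by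
    refine integral_congr_ae (Eventually.of_forall fun x => ?_)
    simp only [Function.comp_apply]
    rw [fderiv_comp x (hk₁.differentiable one_ne_zero _) (hf₁.differentiable one_ne_zero x)]
    simp [ContinuousLinearMap.det, LinearMap.det_comp, mul_assoc]
  have key := setIntegral_comp_mul_det hf₁ hW hWb hV.measurableSet hVb
    (continuous_cubeBump_mul_det hk₁) (d := d) (show 0 < δ / 4 by positivity)
    fun y hy ε hε hεδ => by
      have hyK : ∀ p ∈ K, δ ≤ ‖p - y‖ := fun p hp => by
        by_contra! hlt
        have h2 : 1 < ‖k₁ y‖ :=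
          hthick (mem_thickening_iff.2 ⟨p, hp, by rwa [dist_comm, dist_eq_norm]⟩)
        exact hy (by rw [cubeBump_eq_zero h2, zero_mul])
      have hyn : y ∉ K := fun h => by simpa using hδ.trans_le (hyK y h)
      have hsy : IsSmoothing (fun x => f x - y) W (fun x => ε⁻¹ • (f₁ x - y)) :=
        ⟨(hf₁.sub contDiff_const).const_smul _, ε⁻¹, by positivity, fun x hx => by
          rw [← smul_sub, sub_sub_sub_cancel_right, norm_smul, Real.norm_of_nonneg (by positivity)]
          have h2 : ‖f₁ x - f x‖ + ε < ‖f x - y‖ := by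
            linarith [hyK _ (hfK x hx), (hff x).trans_le (min_le_left _ _)]
          calc ε⁻¹ * ‖f₁ x - f x‖ + 1 = ε⁻¹ * (‖f₁ x - f x‖ + ε) := by field_simp
            _ < _ := mul_lt_mul_of_pos_left h2 (by positivity)⟩
      rw [← hsy.deg_eq hW hWb]
      by_cases hyV : y ∈ V
      · simp [hyV, h1 y hyV hyn]
      · simp [hyV, h0 y hyV hyn]
  rw [← hcomp, ← hsc.deg_eq hW hWb] at key
  have h2 : ((deg (fun x => k (f x) - z) W : ℤ) : ℝ) =
      ((deg (fun y => k y - z) V * d : ℤ) : ℝ) := by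
    rw [key, Int.cast_mul, hs.deg_eq hV hVb, mul_comm]
    rfl
  exact_mod_cast h2

end Mollifier

section Sheets

open Topology

variable {X Y : Type*} [TopologicalSpace X] [TopologicalSpace Y]

lemma Path.Homotopic.Quotient.map_trans {a b c : X} (p : Path.Homotopic.Quotient a b)
    (q : Path.Homotopic.Quotient b c) (F : C(X, Y)) :
    (p.trans q).map F = (p.map F).trans (q.map F) := by
  induction p with | mk p
  induction q with | mk q
  rw [← Path.Homotopic.Quotient.mk_trans, ← Path.Homotopic.Quotient.mk_map, ← Path.Homotopic.Quotient.mk_map, ← Path.Homotopic.Quotient.mk_map,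
    ← Path.Homotopic.Quotient.mk_trans, Path.map_trans]

lemma Path.Homotopic.Quotient.map_symm {a b : X} (p : Path.Homotopic.Quotient a b) (F : C(X, Y)) :
    p.symm.map F = (p.map F).symm := by
  induction p with | mk p
  rw [← Path.Homotopic.Quotient.mk_symm, ← Path.Homotopic.Quotient.mk_map, ← Path.Homotopic.Quotient.mk_map, ← Path.Homotopic.Quotient.mk_symm, Path.map_symm]

lemma Path.Homotopic.Quotient.symm_trans_cancel {a b c : X} (p : Path.Homotopic.Quotient a b)
    (q : Path.Homotopic.Quotient b c) : p.symm.trans (p.trans q) = q := by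
  rw [← Path.Homotopic.Quotient.trans_assoc, Path.Homotopic.Quotient.symm_trans, Path.Homotopic.Quotient.refl_trans]

lemma Path.Homotopic.Quotient.trans_symm_cancel {a b c : X} (p : Path.Homotopic.Quotient a b)
    (q : Path.Homotopic.Quotient a c) : p.trans (p.symm.trans q) = q := by
  rw [← Path.Homotopic.Quotient.trans_assoc, Path.Homotopic.Quotient.trans_symm, Path.Homotopic.Quotient.refl_trans]

/-- `B` is path connected, and paths in `B` with the same endpoints are homotopic in `Y`. -/
structure IsTame (B : Set Y) : Prop where
  joined : ∀ y ∈ B, ∀ y' ∈ B, ∃ p : Path y y', ∀ t, p t ∈ B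
  homotopic : ∀ (y y' : Y) (p q : Path y y'), (∀ t, p t ∈ B) → (∀ t, q t ∈ B) → p.Homotopic q

lemma Path.trans_mem {a b c : X} {p : Path a b} {q : Path b c} {B : Set X} (hp : ∀ t, p t ∈ B)
    (hq : ∀ t, q t ∈ B) (t : I) : p.trans q t ∈ B := by
  have h : (p.trans q) t ∈ Set.range (p.trans q) := ⟨t, rfl⟩
  rw [Path.trans_range] at h
  rcases h with ⟨s, hs⟩ | ⟨s, hs⟩
  · exact hs ▸ hp s
  · exact hs ▸ hq s

/-- The points of `X` that are endpoints of a path starting at `x₀` whose image under `F` is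
homotopic to a path in the class `g` followed by a path in `B`. -/
def sheet (F : C(X, Y)) {x₀ : X} {y : Y} (g : Path.Homotopic.Quotient (F x₀) y) (B : Set Y) :
    Set X :=
  {u | ∃ (a : Path.Homotopic.Quotient x₀ u) (β : Path y (F u)), (∀ t, β t ∈ B) ∧
    a.map F = g.trans (Path.Homotopic.Quotient.mk β)}

variable {F : C(X, Y)} {x₀ : X} {y y' : Y} {g g' : Path.Homotopic.Quotient (F x₀) y} {B B' : Set Y}

lemma map_mem_of_mem_sheet {u : X} (hu : u ∈ sheet F g B) : F u ∈ B := by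
  obtain ⟨-, β, hβ, -⟩ := hu
  simpa using hβ 1

lemma sheet_subset_sheet_trans (δ : Path y y') (hδ : ∀ t, δ t ∈ B) :
    sheet F g B ⊆ sheet F (g.trans (Path.Homotopic.Quotient.mk δ)) B := by
  rintro u ⟨a, β, hβ, ha⟩
  refine ⟨a, δ.symm.trans β, Path.trans_mem (fun t => hδ _) hβ, ?_⟩
  rw [ha, Path.Homotopic.Quotient.mk_trans, Path.Homotopic.Quotient.mk_symm, Path.Homotopic.Quotient.trans_assoc, Path.Homotopic.Quotient.trans_symm_cancel]

lemma sheet_trans (δ : Path y y') (hδ : ∀ t, δ t ∈ B) :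
    sheet F (g.trans (Path.Homotopic.Quotient.mk δ)) B = sheet F g B := by
  refine (sheet_subset_sheet_trans δ hδ).antisymm' ?_
  have := sheet_subset_sheet_trans (F := F) (g := g.trans (Path.Homotopic.Quotient.mk δ)) δ.symm fun t => hδ _
  rwa [Path.Homotopic.Quotient.mk_symm, Path.Homotopic.Quotient.trans_assoc, Path.Homotopic.Quotient.trans_symm, Path.Homotopic.Quotient.trans_refl] at this

lemma mem_sheet_of_path {u v : X} (hu : u ∈ sheet F g B) (p : Path u v) (hp : ∀ t, F (p t) ∈ B) :
    v ∈ sheet F g B := by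
  obtain ⟨a, β, hβ, ha⟩ := hu
  refine ⟨a.trans (Path.Homotopic.Quotient.mk p), β.trans (p.map F.continuous), Path.trans_mem hβ hp, ?_⟩
  rw [Path.Homotopic.Quotient.map_trans, ha, Path.Homotopic.Quotient.mk_trans, Path.Homotopic.Quotient.mk_map, Path.Homotopic.Quotient.trans_assoc]

lemma sheet_subset_of_mem_of_mem (hB : IsTame B) {u : X} (hu : u ∈ sheet F g B)
    (hu' : u ∈ sheet F g' B) : sheet F g B ⊆ sheet F g' B := by
  rintro v ⟨a, β, hβ, ha⟩
  obtain ⟨a₁, β₁, hβ₁, h₁⟩ := hu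
  obtain ⟨a₂, β₂, hβ₂, h₂⟩ := hu'
  refine ⟨a₂.trans (a₁.symm.trans a), β, hβ, ?_⟩
  rw [Path.Homotopic.Quotient.map_trans, Path.Homotopic.Quotient.map_trans, Path.Homotopic.Quotient.map_symm, ha, h₁, h₂,
    Path.Homotopic.Quotient.eq.2 (hB.homotopic _ _ β₁ β₂ hβ₁ hβ₂)]
  have h : g.trans (Path.Homotopic.Quotient.mk β) = (g.trans (Path.Homotopic.Quotient.mk β₂)).trans
      ((Path.Homotopic.Quotient.mk β₂).symm.trans (Path.Homotopic.Quotient.mk β)) := by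
    rw [Path.Homotopic.Quotient.trans_assoc, Path.Homotopic.Quotient.trans_symm_cancel]
  rw [h, Path.Homotopic.Quotient.symm_trans_cancel, Path.Homotopic.Quotient.trans_assoc, Path.Homotopic.Quotient.trans_symm_cancel]

lemma sheet_mono (h : B' ⊆ B) : sheet F g B' ⊆ sheet F g B := by
  rintro u ⟨a, β, hβ, ha⟩
  exact ⟨a, β, fun t => h (hβ t), ha⟩

lemma mem_sheet_of_subset (hB : IsTame B) (hB' : IsTame B') (h : B' ⊆ B) {u : X}
    (hu : u ∈ sheet F g B) (hy : y ∈ B') (huB : F u ∈ B') : u ∈ sheet F g B' := by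
  obtain ⟨a, β, hβ, ha⟩ := hu
  obtain ⟨β', hβ'⟩ := hB'.joined y hy _ huB
  exact ⟨a, β', hβ', by
    rw [ha, Path.Homotopic.Quotient.eq.2 (hB.homotopic _ _ β β' hβ fun t => h (hβ' t))]⟩

lemma exists_mem_sheet [PathConnectedSpace X] (x₀ u : X) (hu : F u = y) (hy : y ∈ B) :
    ∃ g : Path.Homotopic.Quotient (F x₀) y, u ∈ sheet F g B := by
  subst hu
  obtain ⟨p⟩ := PathConnectedSpace.joined x₀ u
  exact ⟨(Path.Homotopic.Quotient.mk p).map F, Path.Homotopic.Quotient.mk p, Path.refl _, fun t => hy, by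
    rw [Path.Homotopic.Quotient.mk_refl, Path.Homotopic.Quotient.trans_refl]⟩

lemma isTame_preimage_of_convex {E : Type*} [NormedAddCommGroup E] [NormedSpace ℝ E] {V C : Set E}
    (hC : Convex ℝ C) (hCV : C ⊆ V) : IsTame ((↑) ⁻¹' C : Set V) where
  joined := by
    intro y hy y' hy'
    obtain ⟨p, hp⟩ := JoinedIn.of_segment_subset (hC.segment_subset hy hy')
    exact ⟨⟨⟨fun t => ⟨p t, hCV (hp t)⟩, by fun_prop⟩, by simp, by simp⟩, hp⟩
  homotopic := by
    intro y y' p q hp hq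
    have hmem : ∀ z : I × I, (1 - (z.1 : ℝ)) • (p z.2 : E) + (z.1 : ℝ) • (q z.2 : E) ∈ C :=
      fun z => hC (hp z.2) (hq z.2) (sub_nonneg.2 z.1.2.2) z.1.2.1 (sub_add_cancel _ _)
    refine ⟨⟨⟨⟨fun z => ⟨_, hCV (hmem z)⟩, by fun_prop⟩, fun t => ?_, fun t => ?_⟩, ?_⟩⟩
    · simp
    · simp
    · rintro t x (rfl | rfl)
      · ext1
        simp [← add_smul]
      · ext1
        simp [← add_smul]

end Sheets

section DegreeApplications

open Topology

variable {ι : Type*} [Fintype ι] [Nonempty ι]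

lemma eventually_deg_sub_const_eq {f : (ι → ℝ) → ι → ℝ} (hf : Continuous f) {W : Set (ι → ℝ)}
    (hW : IsOpen W) (hWb : Bornology.IsBounded W) {y : ι → ℝ} (hy : ∀ x ∈ frontier W, f x ≠ y) :
    ∀ᶠ y' in 𝓝 y, deg (fun x => f x - y') W = deg (fun x => f x - y) W := by
  have hc : IsClosed (f '' frontier W) := (hWb.isCompact_frontier.image hf).isClosed
  obtain ⟨ε, hε, hball⟩ := Metric.isOpen_iff.1 hc.isOpen_compl y (by
    rintro ⟨x, hx, h⟩
    exact hy x hx h)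
  filter_upwards [ball_mem_nhds y hε] with y' hy'
  refine deg_eq_of_homotopy (by fun_prop) (by fun_prop) hW hWb fun x hx t ht h => ?_
  have hmem : (1 - t) • y' + t • y ∈ ball y ε :=
    convex_ball y ε hy' (mem_ball_self hε) (sub_nonneg.2 ht.2) ht.1 (sub_add_cancel _ _)
  refine hball hmem ⟨x, hx, ?_⟩
  rw [← sub_eq_zero, ← h]
  module

lemma deg_sub_const_eq_of_isPreconnected {f : (ι → ℝ) → ι → ℝ} (hf : Continuous f)
    {W T : Set (ι → ℝ)} (hW : IsOpen W) (hWb : Bornology.IsBounded W) (hT : IsPreconnected T)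
    (h : ∀ x ∈ frontier W, f x ∉ T) {y y' : ι → ℝ} (hy : y ∈ T) (hy' : y' ∈ T) :
    deg (fun x => f x - y) W = deg (fun x => f x - y') W := by
  refine hT.constant (f := fun y => deg (fun x => f x - y) W) (fun z hz => ?_) hy hy'
  refine ContinuousAt.continuousWithinAt (tendsto_const_nhds.congr' ?_)
  filter_upwards [eventually_deg_sub_const_eq hf hW hWb fun x hx hxz => h x hx (hxz ▸ hz)]
    with z' hz' using hz'.symm

lemma exists_mul_deg_eq_one {f k : (ι → ℝ) → ι → ℝ} (hf : Continuous f) (hk : Continuous k)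
    {U V S S' : Set (ι → ℝ)} (hU : IsOpen U) (hUb : Bornology.IsBounded U) (hUne : U.Nonempty)
    (hUS : frontier U ⊆ S) (hUd : Disjoint U S) (hV : IsOpen V) (hVb : Bornology.IsBounded V)
    (hVc : IsPreconnected V) (hVS : frontier V ⊆ S') (hVd : Disjoint V S') (hS' : IsCompact S')
    (hfU : MapsTo f U V) (hfS : MapsTo f S S') (hkS : MapsTo k S' S) (hkf : ∀ x ∈ S, k (f x) = x) :
    ∃ m : ℤ, ∀ y ∈ V, m * deg (fun x => f x - y) U = 1 := by
  obtain ⟨z, hz⟩ := hUne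
  have hconst : ∀ y ∈ V, deg (fun x => f x - y) U = deg (fun x => f x - f z) U := fun y hy =>
    deg_sub_const_eq_of_isPreconnected hf hU hUb hVc
      (fun x hx hxV => hVd.notMem_of_mem_left hxV (hfS (hUS hx))) hy (hfU hz)
  have hzS : z ∉ S := hUd.notMem_of_mem_left hz
  have h := deg_comp_sub_const hf hk hU hUb hV hVb hS' (fun x hx => hfS (hUS hx)) hVS (z := z)
    (fun y hy hyz => hzS (hyz ▸ hkS hy)) (fun y hy _ => hconst y hy) fun y hy hyS =>
      deg_eq_zero (by fun_prop) hU hUb fun x hx hxy => ?_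
  · refine ⟨deg (fun y => k y - z) V, fun y hy => ?_⟩
    rw [hconst y hy, ← h, ← deg_sub_const_self hU hUb hz]
    refine deg_congr (by fun_prop) (by fun_prop) hU hUb (fun x hx => ?_) fun x hx => ?_
    · rw [hkf x (hUS hx)]
    · rw [hkf x (hUS hx), sub_ne_zero]
      exact fun hxz => hzS (hxz ▸ hUS hx)
  · rw [closure_eq_self_union_frontier] at hx
    rw [← sub_eq_zero.1 hxy] at hy hyS
    exact hx.elim (fun hx => hy (hfU hx)) fun hx => hyS (hfS (hUS hx))

lemma exists_deg_sub_const_ne_zero {f k : (ι → ℝ) → ι → ℝ} (hf : Continuous f) (hk : Continuous k)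
    {W : Set (ι → ℝ)} (hW : IsOpen W) (hWb : Bornology.IsBounded W) (hWne : W.Nonempty)
    (hkf : ∀ x ∈ frontier W, k (f x) = x) :
    ∃ y, (∀ x ∈ frontier W, f x ≠ y) ∧ deg (fun x => f x - y) W ≠ 0 := by
  obtain ⟨z, hz⟩ := hWne
  have hzW : z ∉ frontier W := fun h => hW.inter_frontier_eq.subset ⟨hz, h⟩
  by_contra! h
  have h' := deg_comp_sub_const hf hk hW hWb isOpen_empty Bornology.isBounded_empty
    (hWb.isCompact_frontier.image hf) (fun x hx => mem_image_of_mem f hx) (by simp) (z := z)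
    (by
      rintro - ⟨x, hx, rfl⟩ hxz
      exact hzW (by rwa [← hxz, hkf x hx])) (d := 0) (by simp)
    fun y _ hy => h y fun x hx hxy => hy ⟨x, hx, hxy⟩
  rw [mul_zero, deg_congr (v := fun x => x - z) (by fun_prop) (by fun_prop) hW hWb
    (fun x hx => by rw [hkf x hx]) (fun x hx => by
      rw [hkf x hx, sub_ne_zero]
      exact fun hxz => hzW (hxz ▸ hx)), deg_sub_const_self hW hWb hz] at h'
  exact one_ne_zero h'

end DegreeApplications

section EuclideanSheets

open Topology Filter

variable {E : Type*} [NormedAddCommGroup E] {U V : Set E} {F : C(↥U, ↥V)}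
  {x₀ : ↥U} {y : ↥V} {g : Path.Homotopic.Quotient (F x₀) y} {C C' : Set E} {f : E → E}

/-- The sheet of `F : U → V` over `C ⊆ V`, as a subset of the ambient vector space. -/
def ambientSheet (F : C(↥U, ↥V)) {x₀ : ↥U} {y : ↥V} (g : Path.Homotopic.Quotient (F x₀) y)
    (C : Set E) : Set E :=
  (↑) '' sheet F g ((↑) ⁻¹' C)

lemma ambientSheet_subset : ambientSheet F g C ⊆ U := by
  rintro - ⟨x, -, rfl⟩
  exact x.2

lemma map_mem_of_mem_ambientSheet (hF : ∀ x : ↥U, (F x : E) = f x) {x : E}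
    (hx : x ∈ ambientSheet F g C) : f x ∈ C := by
  obtain ⟨u, hu, rfl⟩ := hx
  have h := map_mem_of_mem_sheet hu
  rwa [mem_preimage, hF u] at h

lemma exists_ball_subset_and_map_mem (hU : IsOpen U) (hC : IsOpen C) (hf : Continuous f) {x : E}
    (hx : x ∈ U) (hxC : f x ∈ C) : ∃ ε > 0, ball x ε ⊆ U ∧ ∀ z ∈ ball x ε, f z ∈ C := by
  obtain ⟨ε, hε, h⟩ := Metric.isOpen_iff.1 (hU.inter (hC.preimage hf)) x ⟨hx, hxC⟩
  exact ⟨ε, hε, fun z hz => (h hz).1, fun z hz => (h hz).2⟩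

variable [NormedSpace ℝ E]

lemma ball_subset_ambientSheet (hF : ∀ x : ↥U, (F x : E) = f x) {a : E} {ε : ℝ}
    (hU : ball a ε ⊆ U) (hC : ∀ x ∈ ball a ε, f x ∈ C) {x : E} (hx : x ∈ ball a ε)
    (hxC : x ∈ ambientSheet F g C) : ball a ε ⊆ ambientSheet F g C := by
  intro v hv
  obtain ⟨u, hu, rfl⟩ := hxC
  obtain ⟨p, hp⟩ := (isTame_preimage_of_convex (convex_ball a ε) hU).joined u hx ⟨v, hU hv⟩ hv
  refine ⟨_, mem_sheet_of_path hu p fun t => ?_, rfl⟩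
  rw [mem_preimage, hF]
  exact hC _ (hp t)

lemma isOpen_ambientSheet (hF : ∀ x : ↥U, (F x : E) = f x) (hf : Continuous f) (hU : IsOpen U)
    (hC : IsOpen C) : IsOpen (ambientSheet F g C) := by
  refine Metric.isOpen_iff.2 fun x hx => ?_
  obtain ⟨ε, hε, hεU, hεC⟩ := exists_ball_subset_and_map_mem hU hC hf (ambientSheet_subset hx)
    (map_mem_of_mem_ambientSheet hF hx)
  exact ⟨ε, hε, ball_subset_ambientSheet hF hεU hεC (mem_ball_self hε) hx⟩

lemma mem_ambientSheet_of_mem_closure (hF : ∀ x : ↥U, (F x : E) = f x) (hf : Continuous f)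
    (hU : IsOpen U) (hcl : ∀ x ∈ closure U, f x ∈ V → x ∈ U) (hC : IsOpen C) (hCV : C ⊆ V) {x : E}
    (hx : x ∈ closure (ambientSheet F g C)) (hxC : f x ∈ C) : x ∈ ambientSheet F g C := by
  obtain ⟨ε, hε, hεU, hεC⟩ := exists_ball_subset_and_map_mem hU hC hf
    (hcl x (closure_mono ambientSheet_subset hx) (hCV hxC)) hxC
  obtain ⟨z, hz, hxz⟩ := Metric.mem_closure_iff.1 hx ε hε
  exact ball_subset_ambientSheet hF hεU hεC (by rwa [mem_ball']) hz (mem_ball_self hε)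

lemma notMem_of_mem_frontier_ambientSheet (hF : ∀ x : ↥U, (F x : E) = f x) (hf : Continuous f)
    (hU : IsOpen U) (hcl : ∀ x ∈ closure U, f x ∈ V → x ∈ U) (hC : IsOpen C) (hCV : C ⊆ V) {x : E}
    (hx : x ∈ frontier (ambientSheet F g C)) : f x ∉ C := fun hxC =>
  (isOpen_ambientSheet hF hf hU hC).inter_frontier_eq.subset
    ⟨mem_ambientSheet_of_mem_closure hF hf hU hcl hC hCV (frontier_subset_closure hx) hxC, hx⟩

end EuclideanSheets

section SheetDegree

open Topology Filter

variable {ι : Type*} [Fintype ι] [Nonempty ι] {U V : Set (ι → ℝ)} {F : C(↥U, ↥V)} {x₀ : ↥U}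
  {f : (ι → ℝ) → ι → ℝ}

lemma deg_ambientSheet_eq_of_subset (hF : ∀ x : ↥U, (F x : ι → ℝ) = f x) (hf : Continuous f)
    (hU : IsOpen U) (hUb : Bornology.IsBounded U) (hcl : ∀ x ∈ closure U, f x ∈ V → x ∈ U)
    {y : ↥V} {g : Path.Homotopic.Quotient (F x₀) y} {C C' : Set (ι → ℝ)} (hC : IsOpen C)
    (hCc : Convex ℝ C) (hCV : C ⊆ V) (hC' : IsOpen C') (hC'c : Convex ℝ C') (hC'C : C' ⊆ C)
    (hy : (y : ι → ℝ) ∈ C') :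
    deg (fun x => f x - y) (ambientSheet F g C) = deg (fun x => f x - y) (ambientSheet F g C') := by
  refine deg_eq_of_subset (by fun_prop) (isOpen_ambientSheet hF hf hU hC)
    (hUb.subset ambientSheet_subset) (isOpen_ambientSheet hF hf hU hC')
    (image_mono (sheet_mono (preimage_mono hC'C))) fun x hx hxC' h => hxC' ?_
  have hxy := sub_eq_zero.1 h
  obtain ⟨u, hu, rfl⟩ :=
    mem_ambientSheet_of_mem_closure hF hf hU hcl hC hCV hx (hxy ▸ hC'C hy)
  refine ⟨u, mem_sheet_of_subset (isTame_preimage_of_convex hCc hCV)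
    (isTame_preimage_of_convex hC'c (hC'C.trans hCV)) (preimage_mono hC'C) hu hy ?_, rfl⟩
  rwa [mem_preimage, hF u, hxy]

lemma deg_ambientSheet_eq (hF : ∀ x : ↥U, (F x : ι → ℝ) = f x) (hf : Continuous f)
    (hU : IsOpen U) (hUb : Bornology.IsBounded U) (hcl : ∀ x ∈ closure U, f x ∈ V → x ∈ U)
    {y : ↥V} {g : Path.Homotopic.Quotient (F x₀) y} {C C' : Set (ι → ℝ)} (hC : IsOpen C)
    (hCc : Convex ℝ C) (hCV : C ⊆ V) (hC' : IsOpen C') (hC'c : Convex ℝ C') (hC'V : C' ⊆ V)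
    (hy : (y : ι → ℝ) ∈ C) (hy' : (y : ι → ℝ) ∈ C') :
    deg (fun x => f x - y) (ambientSheet F g C) = deg (fun x => f x - y) (ambientSheet F g C') :=
  (deg_ambientSheet_eq_of_subset hF hf hU hUb hcl hC hCc hCV (hC.inter hC') (hCc.inter hC'c)
    inter_subset_left ⟨hy, hy'⟩).trans
  (deg_ambientSheet_eq_of_subset hF hf hU hUb hcl hC' hC'c hC'V (hC.inter hC') (hCc.inter hC'c)
    inter_subset_right ⟨hy, hy'⟩).symm

lemma deg_ambientSheet_trans (hF : ∀ x : ↥U, (F x : ι → ℝ) = f x) (hf : Continuous f)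
    (hU : IsOpen U) (hUb : Bornology.IsBounded U) (hV : IsOpen V)
    (hcl : ∀ x ∈ closure U, f x ∈ V → x ∈ U) {y z : ↥V} (g : Path.Homotopic.Quotient (F x₀) y)
    (γ : Path y z) {C C' : Set (ι → ℝ)} (hC : IsOpen C) (hCc : Convex ℝ C) (hCV : C ⊆ V)
    (hC' : IsOpen C') (hC'c : Convex ℝ C') (hC'V : C' ⊆ V) (hy : (y : ι → ℝ) ∈ C)
    (hz : (z : ι → ℝ) ∈ C') :
    deg (fun x => f x - y) (ambientSheet F g C) =
      deg (fun x => f x - z) (ambientSheet F (g.trans (Path.Homotopic.Quotient.mk γ)) C') := by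
  obtain ⟨γ', rfl, rfl⟩ := γ
  set γ : Path (γ'.toFun 0) (γ'.toFun 1) := ⟨γ', rfl, rfl⟩
  let G : ∀ t : I, Path.Homotopic.Quotient (F x₀) (γ t) := fun t =>
    g.trans (Path.Homotopic.Quotient.mk (γ.subpath 0 t))
  choose r hr hrV using fun v : ↥V => Metric.isOpen_iff.1 hV v v.2
  let B : I → Set (ι → ℝ) := fun t => ball (γ t) (r (γ t))
  let d : I → ℤ := fun t => deg (fun x => f x - γ t) (ambientSheet F (G t) (B t))
  have hloc : IsLocallyConstant d := by
    refine (IsLocallyConstant.iff_eventually_eq d).2 fun t₀ => ?_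
    have hnhds : γ ⁻¹' ((↑) ⁻¹' B t₀) ∈ 𝓝 t₀ :=
      ((isOpen_ball.preimage continuous_subtype_val).preimage γ.continuous).mem_nhds
        (mem_ball_self (hr _))
    filter_upwards [((tendsto_const_nhds (x := t₀)).uIcc tendsto_id).eventually
      (eventually_smallSets_subset.2 hnhds)] with t ht
    have hsub : ∀ s, γ.subpath t₀ t s ∈ ((↑) ⁻¹' B t₀ : Set ↥V) := by
      intro s
      have hs : γ.subpath t₀ t s ∈ range (γ.subpath t₀ t) := ⟨s, rfl⟩
      rw [Path.range_subpath] at hs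
      obtain ⟨s', hs', h⟩ := hs
      exact h ▸ ht hs'
    have hγt : (γ t : ι → ℝ) ∈ B t₀ := by simpa using hsub 1
    have hG : G t = (G t₀).trans (Path.Homotopic.Quotient.mk (γ.subpath t₀ t)) := by
      simp only [G]
      rw [Path.Homotopic.Quotient.trans_assoc, ← Path.Homotopic.Quotient.mk_trans,
        Path.Homotopic.Quotient.eq.2 ⟨Path.Homotopy.subpathTransSubpath γ 0 t₀ t⟩]
    calc d t = deg (fun x => f x - γ t) (ambientSheet F (G t) (B t₀)) :=
          deg_ambientSheet_eq hF hf hU hUb hcl isOpen_ball (convex_ball _ _) (hrV _) isOpen_ball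
            (convex_ball _ _) (hrV _) (mem_ball_self (hr _)) hγt
      _ = deg (fun x => f x - γ t) (ambientSheet F (G t₀) (B t₀)) := by
          rw [hG, ambientSheet, sheet_trans _ hsub, ambientSheet]
      _ = d t₀ := deg_sub_const_eq_of_isPreconnected hf (isOpen_ambientSheet hF hf hU isOpen_ball)
          (hUb.subset ambientSheet_subset) (convex_ball _ _).isPreconnected
          (fun x hx => notMem_of_mem_frontier_ambientSheet hF hf hU hcl isOpen_ball (hrV _) hx) hγt
          (mem_ball_self (hr _))
  have h0 : G 0 = g := by
    simp only [G]
    rw [Path.subpath_self]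
    exact Path.Homotopic.Quotient.trans_refl g
  have h1 : G 1 = g.trans (Path.Homotopic.Quotient.mk γ) := by
    simp only [G]
    rw [Path.subpath_zero_one]
    rfl
  have e0 : d 0 = deg (fun x => f x - γ 0) (ambientSheet F g C) := by
    simp only [d, h0]
    exact deg_ambientSheet_eq hF hf hU hUb hcl isOpen_ball (convex_ball _ _) (hrV _) hC hCc hCV
      (mem_ball_self (hr _)) hy
  have e1 : d 1 = deg (fun x => f x - γ 1)
      (ambientSheet F (g.trans (Path.Homotopic.Quotient.mk γ)) C') := by
    simp only [d, h1]
    exact deg_ambientSheet_eq hF hf hU hUb hcl isOpen_ball (convex_ball _ _) (hrV _) hC' hC'c hC'V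
      (mem_ball_self (hr _)) hz
  exact e0.symm.trans ((hloc.apply_eq_of_preconnectedSpace 0 1).trans e1)

theorem exists_path_map_homotopic_of_deg (hF : ∀ x : ↥U, (F x : ι → ℝ) = f x) (hf : Continuous f)
    (hU : IsOpen U) (hUb : Bornology.IsBounded U) (hUc : IsConnected U) (hV : IsOpen V)
    (hcl : ∀ x ∈ closure U, f x ∈ V → x ∈ U) {m : ℤ}
    (hm : ∀ y ∈ V, m * deg (fun x => f x - y) U = 1) (γ : Path (F x₀) (F x₀)) :
    ∃ γ' : Path x₀ x₀, (γ'.map F.continuous).Homotopic γ := by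
  classical
  have : PathConnectedSpace ↥U :=
    isPathConnected_iff_pathConnectedSpace.1 (hU.isConnected_iff_isPathConnected.1 hUc)
  obtain ⟨r, hr, hrV⟩ := Metric.isOpen_iff.1 hV _ (F x₀).2
  set C := ball (F x₀ : ι → ℝ) r
  have hCt := isTame_preimage_of_convex (convex_ball (F x₀ : ι → ℝ) r) hrV
  have hyC : (F x₀ : ι → ℝ) ∈ C := mem_ball_self hr
  let T : Path.Homotopic.Quotient (F x₀) (F x₀) → Set (ι → ℝ) := fun g => ambientSheet F g C
  have hTo : ∀ g, IsOpen (T g) := fun g => isOpen_ambientSheet hF hf hU isOpen_ball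
  have hTU : ∀ g, T g ⊆ U := fun g => ambientSheet_subset
  have hTeq : ∀ g g' x, x ∈ T g → x ∈ T g' → T g = T g' := by
    rintro g g' - ⟨u, hu, rfl⟩ ⟨u', hu', h⟩
    obtain rfl := Subtype.ext h
    exact congrArg (Subtype.val '' ·) ((sheet_subset_of_mem_of_mem hCt hu hu').antisymm
      (sheet_subset_of_mem_of_mem hCt hu' hu))
  have hTcl : ∀ g x, x ∈ closure (T g) → f x = F x₀ → x ∈ T g := fun g x hx h =>
    mem_ambientSheet_of_mem_closure hF hf hU hcl isOpen_ball hrV hx (by rwa [h])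
  have hZ : IsCompact (closure U ∩ f ⁻¹' {↑(F x₀)}) :=
    (Metric.isCompact_of_isClosed_isBounded isClosed_closure hUb.closure).inter_right
      (isClosed_singleton.preimage hf)
  obtain ⟨s, hs⟩ := hZ.elim_finite_subcover T hTo (by
    rintro x ⟨hx, hxy⟩
    have hxU : x ∈ U := hcl x hx (by rw [hxy]; exact (F x₀).2)
    obtain ⟨g, hg⟩ := exists_mem_sheet (F := F) (B := (↑) ⁻¹' C) x₀ ⟨x, hxU⟩
      (Subtype.ext ((hF _).trans hxy)) (mem_preimage.2 hyC)
    exact mem_iUnion.2 ⟨g, _, hg, rfl⟩)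
  have hmem : ∀ x ∈ closure U, f x = F x₀ → ∃ A ∈ s.image T, x ∈ A := fun x hx hxy => by
    simpa using hs ⟨hx, hxy⟩
  set g₀ : Path.Homotopic.Quotient (F x₀) (F x₀) := Path.Homotopic.Quotient.refl _
  set d : ℤ := deg (fun x => f x - F x₀) (T g₀)
  have hd : ∀ g, deg (fun x => f x - F x₀) (T g) = d := fun g => by
    obtain ⟨p, rfl⟩ := Path.Homotopic.Quotient.mk_surjective g
    have h := deg_ambientSheet_trans hF hf hU hUb hV hcl g₀ p isOpen_ball (convex_ball _ r) hrV
      isOpen_ball (convex_ball _ r) hrV hyC hyC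
    rw [Path.Homotopic.Quotient.refl_trans] at h
    exact h.symm
  have hsum : deg (fun x => f x - F x₀) U = (s.image T).card * d := by
    rw [deg_eq_sum (by fun_prop) hU hUb (s.image T) id, Finset.sum_congr rfl (g := fun _ => d)]
    · simp
    · intro A hA
      obtain ⟨g, -, rfl⟩ := Finset.mem_image.1 hA
      exact hd g
    · intro A hA
      obtain ⟨g, -, rfl⟩ := Finset.mem_image.1 hA
      exact hTo g
    · intro A hA
      obtain ⟨g, -, rfl⟩ := Finset.mem_image.1 hA
      exact hTU g
    · intro A hA A' hA' hne
      obtain ⟨g, -, rfl⟩ := Finset.mem_image.1 hA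
      obtain ⟨g', -, rfl⟩ := Finset.mem_image.1 hA'
      exact disjoint_left.2 fun x hx hx' => hne (hTeq g g' x hx hx')
    · intro x hx hxs h
      obtain ⟨A, hA, hxA⟩ := hmem x hx (sub_eq_zero.1 h)
      exact hxs A hA hxA
  have hone := hm _ (F x₀).2
  rw [hsum] at hone
  have hd0 : d ≠ 0 := by
    rintro h
    simp [h] at hone
  obtain ⟨A, hA⟩ : ∃ A, s.image T = {A} := by
    refine Finset.card_eq_one.1 ?_
    have h : ((s.image T).card : ℤ) ∣ 1 := ⟨m * d, by rw [← hone]; ring⟩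
    exact_mod_cast Int.eq_one_of_dvd_one (by positivity) h
  have hTA : ∀ g, T g = A := fun g => by
    obtain ⟨x, hx, hxy⟩ : ∃ x ∈ closure (T g), f x - F x₀ = 0 := by
      by_contra! h
      exact hd0 ((hd g).symm.trans (deg_eq_zero (by fun_prop) (hTo g) (hUb.subset (hTU g)) h))
    rw [sub_eq_zero] at hxy
    obtain ⟨A', hA', hxA'⟩ := hmem x (closure_mono (hTU g) hx) hxy
    obtain ⟨g', -, rfl⟩ := Finset.mem_image.1 hA'
    rw [hA, Finset.mem_singleton] at hA'
    rw [← hA']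
    exact hTeq g g' x (hTcl g x hx hxy) hxA'
  have hx₀ : (x₀ : ι → ℝ) ∈ T g₀ :=
    ⟨x₀, ⟨Path.Homotopic.Quotient.refl x₀, Path.refl _, fun _ => hyC, by
      rw [Path.Homotopic.Quotient.mk_refl, Path.Homotopic.Quotient.trans_refl]
      rfl⟩, rfl⟩
  rw [hTA, ← hTA (Path.Homotopic.Quotient.mk γ)] at hx₀
  obtain ⟨u, ⟨a, β, hβ, ha⟩, hu⟩ := hx₀
  obtain rfl := Subtype.ext hu
  obtain ⟨γ', rfl⟩ := Path.Homotopic.Quotient.mk_surjective a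
  refine ⟨γ', Path.Homotopic.Quotient.eq.1 ?_⟩
  rw [Path.Homotopic.Quotient.mk_map, ha,
    Path.Homotopic.Quotient.eq.2 (hCt.homotopic _ _ β (Path.refl _) hβ fun _ => hyC),
    Path.Homotopic.Quotient.mk_refl, Path.Homotopic.Quotient.trans_refl]

end SheetDegree

section SphereTopology

open Topology Filter

lemma Topology.IsEmbedding.exists_lift {X Y Z : Type*} [TopologicalSpace X] [TopologicalSpace Y]
    [TopologicalSpace Z] {τ : Y → Z} (hτ : IsEmbedding τ) {e : X → Z} (he : Continuous e)
    (h : ∀ x, e x ∈ range τ) : ∃ b : X → Y, Continuous b ∧ ∀ x, τ (b x) = e x := by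
  choose b hb using h
  refine ⟨b, hτ.continuous_iff.2 ?_, hb⟩
  rwa [show τ ∘ b = e from funext hb]

lemma Topology.IsClosedEmbedding.exists_continuous_extension {X E κ : Type*} [TopologicalSpace X]
    [TopologicalSpace E] [NormalSpace E] {a : X → E} (ha : IsClosedEmbedding a) {b : X → κ → ℝ}
    (hb : Continuous b) : ∃ J : E → κ → ℝ, Continuous J ∧ ∀ x, J (a x) = b x := by
  obtain ⟨J, hJ⟩ := ContinuousMap.exists_extension ha ⟨b, hb⟩
  exact ⟨J, J.continuous, fun x => congrArg (fun h : C(X, κ → ℝ) => h x) hJ⟩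

lemma Topology.IsEmbedding.exists_mem_nhds_preimage_subset {Y Z : Type*} [TopologicalSpace Y]
    [TopologicalSpace Z] {τ : Y → Z} (hτ : IsEmbedding τ) {y : Y} {s : Set Y} (hs : s ∈ 𝓝 y) :
    ∃ O ∈ 𝓝 (τ y), τ ⁻¹' O ⊆ s := by
  rwa [hτ.nhds_eq_comap] at hs

lemma exists_isEmbedding_range_eq_sphere_sdiff {n : ℕ} {Q : Amb n} (hQ : Q ∈ Sph n) :
    ∃ τ : (Fin n → ℝ) → Amb n, IsEmbedding τ ∧ range τ = Sph n \ {Q} := by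
  have : Fact (Module.finrank ℝ (Amb n) = n + 1) := ⟨by simp⟩
  let e := stereographic' n (⟨Q, hQ⟩ : sphere (0 : Amb n) 1)
  have he : e.symm.source = univ := stereographic'_target _
  let L := (EuclideanSpace.equiv (Fin n) ℝ).symm.toHomeomorph
  refine ⟨fun z => e.symm (L z), IsEmbedding.subtypeVal.comp
    (e.symm.isOpenEmbedding he |>.isEmbedding.comp L.isEmbedding), ?_⟩
  have h : range e.symm = {⟨Q, hQ⟩}ᶜ := by
    rw [← image_univ, ← he, e.symm.image_source_eq_target, OpenPartialHomeomorph.symm_target,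
      stereographic'_source]
  have h' : range (fun z => e.symm (L z)) = range e.symm := L.surjective.range_comp e.symm
  rw [show (fun z => (e.symm (L z) : Amb n)) = Subtype.val ∘ fun z => e.symm (L z) from rfl,
    range_comp, h', h]
  ext x
  constructor
  · rintro ⟨u, hu, rfl⟩
    exact ⟨u.2, fun hx => hu (Subtype.ext hx)⟩
  · rintro ⟨hx, hxQ⟩
    exact ⟨⟨x, hx⟩, fun hu => hxQ (congrArg Subtype.val hu), rfl⟩

lemma exists_mem_sphere_ne {n : ℕ} (x : Amb n) : ∃ Q ∈ Sph n, Q ≠ x := by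
  by_contra! h
  have h0 : EuclideanSpace.single 0 1 = x := h _ (by simp [Sph])
  have h1 : -EuclideanSpace.single 0 1 = x := h _ (by simp [Sph])
  have := congrArg (fun v : Amb n => v 0) (h0.trans h1.symm)
  norm_num at this

lemma isCompact_sphere_amb (n : ℕ) : IsCompact (Sph n) := isCompact_sphere 0 1

/-- The complement in the sphere of an embedded sphere of codimension one is not connected. -/
theorem not_isPreconnected_sphere_sdiff_range {m : ℕ} {e : ↥(Sph m) → Amb (m + 1)}
    (he : Continuous e) (hinj : Function.Injective e) (hrange : range e ⊆ Sph (m + 1))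
    {P : Amb (m + 1)} (hP : P ∈ Sph (m + 1) \ range e) :
    ¬ IsPreconnected (Sph (m + 1) \ range e) := by
  intro hconn
  have : CompactSpace ↥(Sph m) := isCompact_iff_compactSpace.1 (isCompact_sphere_amb m)
  obtain ⟨τ, hτ, hτr⟩ := exists_isEmbedding_range_eq_sphere_sdiff hP.1
  obtain ⟨b, hb, hτb⟩ := hτ.exists_lift he fun x => by
    rw [hτr]
    exact ⟨hrange ⟨x, rfl⟩, fun h => hP.2 ⟨x, h⟩⟩
  have hbi : Function.Injective b := fun x y hxy => hinj (by rw [← hτb, hxy, hτb])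
  let L := (EuclideanSpace.equiv (Fin (m + 1)) ℝ).toHomeomorph
  let a : ↥(Sph m) → Fin (m + 1) → ℝ := fun x => L x
  have ha : IsClosedEmbedding a :=
    (L.continuous.comp continuous_subtype_val).isClosedEmbedding
      (L.injective.comp Subtype.val_injective)
  obtain ⟨J, hJ, hJa⟩ := ha.exists_continuous_extension hb
  obtain ⟨k, hk, hkb⟩ := (hb.isClosedEmbedding hbi).exists_continuous_extension ha.continuous
  let W := L.symm ⁻¹' ball 0 1
  have hW : IsOpen W := isOpen_ball.preimage L.symm.continuous
  have hWb : Bornology.IsBounded W :=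
    (L.symm.isCompact_preimage.2 (isCompact_closedBall 0 1)).isBounded.subset
      (preimage_mono ball_subset_closedBall)
  have hfr : ∀ x ∈ frontier W, ∃ s, a s = x := by
    intro x hx
    rw [← L.symm.preimage_frontier, frontier_ball _ one_ne_zero] at hx
    exact ⟨⟨L.symm x, hx⟩, L.apply_symm_apply x⟩
  have hfra : ∀ s, a s ∈ frontier W := by
    intro s
    rw [← L.symm.preimage_frontier, frontier_ball _ one_ne_zero, mem_preimage]
    simp only [a, L.symm_apply_apply]
    exact s.2
  obtain ⟨y, hy, hdeg⟩ := exists_deg_sub_const_ne_zero hJ hk hW hWb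
    ⟨L 0, by simp [W]⟩ fun x hx => by
      obtain ⟨s, rfl⟩ := hfr x hx
      rw [hJa, hkb]
  let d : Amb (m + 1) → ℤ := Function.extend τ (fun z => deg (fun x => J x - z) W) 0
  have hdτ : ∀ z, d (τ z) = deg (fun x => J x - z) W := hτ.injective.extend_apply _ _
  have hd0 : ∀ w, (¬ ∃ z, τ z = w) → d w = 0 := Function.extend_apply' _ _
  have hdP : d P = 0 := hd0 P fun ⟨z, hz⟩ => by
    have := hτr ▸ mem_range_self (f := τ) z
    exact this.2 hz
  have hmem : ∀ z, (∀ x ∈ frontier W, J x ≠ z) → τ z ∈ Sph (m + 1) \ range e := by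
    intro z hz
    refine ⟨(hτr ▸ mem_range_self (f := τ) z : τ z ∈ Sph (m + 1) \ {P}).1, ?_⟩
    rintro ⟨s, hs⟩
    exact hz _ (hfra s) ((hJa s).trans (hτ.injective ((hτb s).trans hs)))
  have hcont : ContinuousOn d (Sph (m + 1) \ range e) := by
    intro x hx
    refine tendsto_const_nhds.congr' (f₁ := fun _ => d x) ?_
    by_cases hxP : x = P
    · subst hxP
      have hK : IsCompact (τ '' (J '' closure W)) :=
        ((Metric.isCompact_of_isClosed_isBounded isClosed_closure hWb.closure).image hJ).image
          hτ.continuous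
      have hxK : x ∉ τ '' (J '' closure W) := by
        rintro ⟨z, -, hz⟩
        exact (hτr ▸ mem_range_self (f := τ) z : τ z ∈ Sph (m + 1) \ {x}).2 hz
      filter_upwards [mem_nhdsWithin_of_mem_nhds (hK.isClosed.isOpen_compl.mem_nhds hxK)] with w hw
      rw [hdP]
      by_cases h : ∃ z, τ z = w
      · obtain ⟨z, rfl⟩ := h
        rw [hdτ]
        refine (deg_eq_zero (by fun_prop) hW hWb fun x hx hxz => hw ?_).symm
        exact ⟨_, ⟨x, hx, sub_eq_zero.1 hxz⟩, rfl⟩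
      · exact (hd0 w h).symm
    · obtain ⟨z, rfl⟩ : x ∈ range τ := hτr ▸ ⟨hx.1, hxP⟩
      obtain ⟨O, hO, hOs⟩ := hτ.exists_mem_nhds_preimage_subset
        (eventually_deg_sub_const_eq hJ hW hWb (y := z) fun x hx' hxz => by
          obtain ⟨s, rfl⟩ := hfr x hx'
          exact hx.2 ⟨s, by rw [← hτb, ← hJa, hxz]⟩)
      filter_upwards [mem_nhdsWithin_of_mem_nhds hO, self_mem_nhdsWithin,
        mem_nhdsWithin_of_mem_nhds (isOpen_compl_singleton.mem_nhds hxP)] with w hwO hw hwP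
      obtain ⟨z', rfl⟩ : w ∈ range τ := hτr ▸ ⟨hw.1, hwP⟩
      rw [hdτ, hdτ]
      exact (hOs hwO).symm
  have := hconn.constant hcont (hmem y hy) hP
  rw [hdP, hdτ] at this
  exact hdeg this

end SphereTopology

namespace CrumpledCube

open Topology Filter

variable {n : ℕ} (C : CrumpledCube n)

lemma isConnected_int : IsConnected C.int := by
  obtain ⟨p, hp, h⟩ := C.int_component
  exact h ▸ isConnected_connectedComponentIn_iff.2 hp

lemma int_subset : C.int ⊆ Sph n \ C.bd := by
  obtain ⟨p, -, h⟩ := C.int_component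
  exact h ▸ connectedComponentIn_subset _ _

lemma carrier_subset_sphere : C.carrier ⊆ Sph n :=
  union_subset C.bd_subset_sphere (C.int_subset.trans sdiff_subset)

lemma disjoint_int_bd : Disjoint C.int C.bd :=
  disjoint_left.2 fun _ hx => (C.int_subset hx).2

lemma subset_int {B : Set (Amb n)} (hB : IsPreconnected B) (hBC : B ⊆ Sph n \ C.bd) {x : Amb n}
    (hx : x ∈ B) (hxC : x ∈ C.int) : B ⊆ C.int := by
  obtain ⟨p, hp, h⟩ := C.int_component
  rw [h] at hxC ⊢
  exact connectedComponentIn_eq hxC ▸ hB.subset_connectedComponentIn hx hBC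

lemma isCompact_bd : IsCompact C.bd := by
  obtain ⟨e, he, -, h⟩ := C.exists_embedding
  have : CompactSpace ↥(Sph (n - 1)) := isCompact_iff_compactSpace.1 (isCompact_sphere_amb _)
  exact h ▸ isCompact_range he

/-- Around each point of a chart of the sphere away from `C.bd` there is a ball that lies in
`C.int` as soon as it meets it. -/
lemma exists_ball_subset_preimage_int {τ : (Fin n → ℝ) → Amb n} (hτ : Continuous τ)
    (hτS : ∀ z, τ z ∈ Sph n) {z : Fin n → ℝ} (hz : τ z ∉ C.bd) :
    ∃ ε > 0, ∀ w ∈ ball z ε, τ w ∈ C.int → ball z ε ⊆ τ ⁻¹' C.int := by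
  obtain ⟨ε, hε, hball⟩ :=
    Metric.isOpen_iff.1 (C.isCompact_bd.isClosed.preimage hτ).isOpen_compl z hz
  refine ⟨ε, hε, fun w hw hwC => image_subset_iff.1 <| C.subset_int
    ((convex_ball z ε).isPreconnected.image τ hτ.continuousOn) ?_ (mem_image_of_mem τ hw) hwC⟩
  rintro - ⟨v, hv, rfl⟩
  exact ⟨hτS v, hball hv⟩

lemma isClosed_carrier : IsClosed C.carrier := by
  refine isClosed_of_closure_subset fun x hx => ?_
  by_cases hxb : x ∈ C.bd
  · exact Or.inl hxb
  have hxS : x ∈ Sph n :=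
    (isCompact_sphere_amb n).isClosed.closure_subset_iff.2 C.carrier_subset_sphere hx
  have hxi : x ∈ closure C.int := by
    rw [carrier, closure_union, C.isCompact_bd.isClosed.closure_eq] at hx
    exact hx.resolve_left hxb
  obtain ⟨Q, hQ, hQx⟩ := exists_mem_sphere_ne x
  obtain ⟨τ, hτ, hτr⟩ := exists_isEmbedding_range_eq_sphere_sdiff hQ
  obtain ⟨z, rfl⟩ : x ∈ range τ := hτr ▸ ⟨hxS, fun h => hQx h.symm⟩
  obtain ⟨ε, hε, hball⟩ := C.exists_ball_subset_preimage_int hτ.continuous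
    (fun z => (hτr ▸ mem_range_self z : τ z ∈ Sph n \ {Q}).1) hxb
  obtain ⟨O, hO, hOs⟩ := hτ.exists_mem_nhds_preimage_subset (ball_mem_nhds z hε)
  obtain ⟨w, ⟨hwO, hwQ⟩, hwC⟩ := mem_closure_iff_nhds.1 hxi (O ∩ {Q}ᶜ)
    (inter_mem hO (isOpen_compl_singleton.mem_nhds fun h => hQx h.symm))
  obtain ⟨w, rfl⟩ : w ∈ range τ := hτr ▸ ⟨(C.int_subset hwC).1, hwQ⟩
  exact Or.inr (hball w (hOs hwO) hwC (mem_ball_self hε))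

instance : CompactSpace ↥C.carrier := isCompact_iff_compactSpace.1
  ((isCompact_sphere_amb n).of_isClosed_subset C.isClosed_carrier C.carrier_subset_sphere)

lemma exists_notMem_carrier (hn : 2 ≤ n) : ∃ Q ∈ Sph n, Q ∉ C.carrier := by
  obtain ⟨m, rfl⟩ : ∃ m, n = m + 1 := ⟨n - 1, by omega⟩
  obtain ⟨e, he, hinj, hr⟩ := C.exists_embedding
  obtain ⟨p, hp, -⟩ := C.int_component
  by_contra! h
  have hint : C.int = Sph (m + 1) \ C.bd :=
    C.int_subset.antisymm fun x hx => (h x hx.1).resolve_left hx.2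
  refine not_isPreconnected_sphere_sdiff_range (m := m) he hinj (hr ▸ C.bd_subset_sphere)
    (hr ▸ hp) ?_
  exact hr ▸ hint ▸ C.isConnected_int.isPreconnected

/-- A crumpled cube embeds in Euclidean space of the same dimension, with open interior. -/
lemma exists_isClosedEmbedding (hn : 2 ≤ n) : ∃ a : ↥C.carrier → Fin n → ℝ, IsClosedEmbedding a ∧
    IsOpen (a '' ((↑) ⁻¹' C.int)) ∧ IsConnected (a '' ((↑) ⁻¹' C.int)) ∧
    frontier (a '' ((↑) ⁻¹' C.int)) ⊆ a '' ((↑) ⁻¹' C.bd) := by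
  obtain ⟨Q, hQ, hQC⟩ := C.exists_notMem_carrier hn
  obtain ⟨τ, hτ, hτr⟩ := exists_isEmbedding_range_eq_sphere_sdiff hQ
  obtain ⟨a, ha, hτa⟩ := hτ.exists_lift (X := ↥C.carrier) continuous_subtype_val fun x => by
    rw [hτr]
    exact ⟨C.carrier_subset_sphere x.2, fun h => hQC (h ▸ x.2)⟩
  have hacl : IsClosedEmbedding a := ha.isClosedEmbedding fun x y hxy =>
    Subtype.ext (by rw [← hτa, hxy, hτa])
  have himage : a '' ((↑) ⁻¹' C.int) = τ ⁻¹' C.int := by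
    ext z
    constructor
    · rintro ⟨x, hx, rfl⟩
      rwa [mem_preimage, hτa]
    · intro hz
      exact ⟨⟨τ z, Or.inr hz⟩, hz, hτ.injective (hτa _)⟩
  have hconn : IsConnected ((↑) ⁻¹' C.int : Set ↥C.carrier) := by
    have himg : ((↑) '' ((↑) ⁻¹' C.int : Set ↥C.carrier) : Set (Amb n)) = C.int := by
      rw [Subtype.image_preimage_coe]
      exact inter_eq_right.2 subset_union_right
    have h := himg.symm ▸ C.isConnected_int
    exact ⟨image_nonempty.1 h.1, IsInducing.subtypeVal.isPreconnected_image.1 h.2⟩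
  have hopen : IsOpen (a '' ((↑) ⁻¹' C.int)) := by
    rw [himage]
    refine Metric.isOpen_iff.2 fun z hz => ?_
    obtain ⟨ε, hε, hball⟩ := C.exists_ball_subset_preimage_int hτ.continuous
      (fun z => (hτr ▸ mem_range_self z : τ z ∈ Sph n \ {Q}).1) (C.int_subset hz).2
    exact ⟨ε, hε, hball z (mem_ball_self hε) hz⟩
  refine ⟨a, hacl, hopen, hconn.image a ha.continuousOn, fun z hz => ?_⟩
  obtain ⟨x, rfl⟩ := hacl.isClosed_range.closure_subset_iff.2 (image_subset_range _ _)
    (frontier_subset_closure hz)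
  exact ⟨x, x.2.resolve_right fun hx =>
    hopen.inter_frontier_eq.subset ⟨mem_image_of_mem a hx, hz⟩, rfl⟩

end CrumpledCube

section

open Topology

/-- A homotopy of paths can be carried along a continuous map defined on an intermediate space. -/
lemma Path.Homotopic.exists_homotopy_of_map {X Y : Type*} [TopologicalSpace X] [TopologicalSpace Y]
    {v w : X} {p q : Path v w} (hpq : p.Homotopic q) {β : X → Y} (hβ : Continuous β) {y z : Y}
    {p' q' : Path y z} (hp : ∀ t, β (p t) = p' t) (hq : ∀ t, β (q t) = q' t) :
    ∃ H : Path.Homotopy p' q', ∀ s, H s ∈ range β := by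
  obtain ⟨H⟩ := hpq
  refine ⟨⟨⟨⟨fun s => β (H s), by fun_prop⟩, fun t => ?_, fun t => ?_⟩, ?_⟩,
    fun s => mem_range_self (H s)⟩
  · simp [hp]
  · simp [hq]
  · rintro s t (rfl | rfl)
    · simp [← hp]
    · simp [← hp]

end

/-- **Corollary 3.1.** If `(C,D,h) ∈ 𝒲_n` with associated map `f`, then
`f(Int C) ⊆ Int D` and `f` induces an epimorphism `π₁(Int C) → π₁(Int D)`. -/
theorem stmt3 (n : ℕ) (hn : 2 ≤ n) (C D : CrumpledCube n) (h : ↥C.bd ≃ₜ ↥D.bd)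
    (f : ↥C.carrier → ↥D.carrier) (hf : IsAssociatedMap C D h f) :
    (∀ x : ↥C.carrier, (x : Amb n) ∈ C.int → ((f x : ↥D.carrier) : Amb n) ∈ D.int) ∧
    (∀ x₀ : ↥C.carrier, (x₀ : Amb n) ∈ C.int →
      ∀ γ : Path (f x₀) (f x₀), (∀ t, ((γ t : ↥D.carrier) : Amb n) ∈ D.int) →
        ∃ γ' : Path x₀ x₀,
          (∀ t, ((γ' t : ↥C.carrier) : Amb n) ∈ C.int) ∧
          ∃ F : Path.Homotopy (γ'.map hf.1) γ,
            ∀ z, ((F z : ↥D.carrier) : Amb n) ∈ D.int) := by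
  have hint : ∀ x : ↥C.carrier, (x : Amb n) ∈ C.int → (f x : Amb n) ∈ D.int := fun x hx =>
    (f x).2.resolve_left fun hfx => C.disjoint_int_bd.notMem_of_mem_left hx ((hf.2.2 x).1 hfx)
  refine ⟨hint, fun x₀ hx₀ γ hγ => ?_⟩
  obtain ⟨m, rfl⟩ : ∃ m, n = m + 1 := ⟨n - 1, by omega⟩
  obtain ⟨a, ha, hUo, hUc, hUfr⟩ := C.exists_isClosedEmbedding hn
  obtain ⟨b, hb, hVo, hVc, hVfr⟩ := D.exists_isClosedEmbedding hn
  set U := a '' ((↑) ⁻¹' C.int)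
  set V := b '' ((↑) ⁻¹' D.int)
  have hUd : Disjoint U (a '' ((↑) ⁻¹' C.bd)) :=
    (disjoint_image_iff ha.injective).2 (C.disjoint_int_bd.preimage _)
  have hVd : Disjoint V (b '' ((↑) ⁻¹' D.bd)) :=
    (disjoint_image_iff hb.injective).2 (D.disjoint_int_bd.preimage _)
  have hUb : Bornology.IsBounded U := (isCompact_range ha.continuous).isBounded.subset (image_subset_range _ _)
  have hVb : Bornology.IsBounded V := (isCompact_range hb.continuous).isBounded.subset (image_subset_range _ _)
  obtain ⟨f₁, hf₁, hf₁a⟩ := ha.exists_continuous_extension (hb.continuous.comp hf.1)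
  have : CompactSpace ↥D.bd := isCompact_iff_compactSpace.1 D.isCompact_bd
  have hbD := (hb.continuous.comp (continuous_inclusion D.bd_subset_carrier)).isClosedEmbedding
    (hb.injective.comp (inclusion_injective D.bd_subset_carrier))
  obtain ⟨k, hk, hkb⟩ := hbD.exists_continuous_extension
    (b := fun y => a (inclusion C.bd_subset_carrier (h.symm y)))
    (ha.continuous.comp ((continuous_inclusion C.bd_subset_carrier).comp h.symm.continuous))
  have hfU : MapsTo f₁ U V := by
    rintro - ⟨x, hx, rfl⟩
    exact ⟨f x, hint x hx, (hf₁a x).symm⟩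
  obtain ⟨d, hd⟩ := exists_mul_deg_eq_one hf₁ hk hUo hUb hUc.1 hUfr hUd hVo hVb hVc.2 hVfr hVd
    ((D.isCompact_bd.isClosed.preimage continuous_subtype_val).isCompact.image hb.continuous) hfU
    (by
      rintro - ⟨x, hx, rfl⟩
      exact ⟨f x, (hf.2.2 x).2 hx, (hf₁a x).symm⟩)
    (by
      rintro - ⟨y, hy, rfl⟩
      exact ⟨_, Subtype.coe_prop (h.symm ⟨y, hy⟩), (hkb ⟨y, hy⟩).symm⟩)
    (by
      rintro - ⟨x, hx, rfl⟩
      have hfx : f x = inclusion D.bd_subset_carrier (h ⟨x, hx⟩) := Subtype.ext (hf.2.1 x hx)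
      rw [hf₁a, Function.comp_apply, hfx]
      exact (hkb _).trans (by rw [h.symm_apply_apply]))
  have hcl : ∀ z ∈ closure U, f₁ z ∈ V → z ∈ U := by
    intro z hz hzV
    rw [closure_eq_self_union_frontier] at hz
    refine hz.resolve_right fun hz => ?_
    obtain ⟨x, hx, rfl⟩ := hUfr hz
    exact hVd.notMem_of_mem_left hzV ⟨f x, (hf.2.2 x).2 hx, (hf₁a x).symm⟩
  obtain ⟨α, hα, haα⟩ := ha.isEmbedding.exists_lift (X := ↥U) continuous_subtype_val
    fun u => image_subset_range _ _ u.2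
  obtain ⟨β, hβ, hbβ⟩ := hb.isEmbedding.exists_lift (X := ↥V) continuous_subtype_val
    fun v => image_subset_range _ _ v.2
  have hαint : ∀ u, (α u : Amb (m + 1)) ∈ C.int := by
    rintro ⟨-, x, hx, rfl⟩
    rwa [ha.injective (haα ⟨a x, x, hx, rfl⟩)]
  have hβint : ∀ v, (β v : Amb (m + 1)) ∈ D.int := by
    rintro ⟨-, y, hy, rfl⟩
    rwa [hb.injective (hbβ ⟨b y, y, hy, rfl⟩)]
  let F : C(↥U, ↥V) := ⟨hfU.restrict, hf₁.continuousOn.mapsToRestrict hfU⟩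
  have hβF : ∀ u, β (F u) = f (α u) := fun u => hb.injective <| by
    rw [hbβ, ← Function.comp_apply (f := b), ← hf₁a, haα]
    rfl
  let u₀ : ↥U := ⟨a x₀, x₀, hx₀, rfl⟩
  have hα₀ : α u₀ = x₀ := ha.injective (haα u₀)
  let γ₁ : Path (F u₀) (F u₀) :=
    { toFun := fun t => ⟨b (γ t), γ t, hγ t, rfl⟩
      continuous_toFun := (hb.continuous.comp γ.continuous).subtype_mk _
      source' := Subtype.ext ((congrArg b γ.source).trans (hf₁a x₀).symm)
      target' := Subtype.ext ((congrArg b γ.target).trans (hf₁a x₀).symm) }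
  obtain ⟨p, hp⟩ := exists_path_map_homotopic_of_deg (F := F) (fun _ => rfl) hf₁ hUo hUb hUc hVo
    hcl hd γ₁
  let γ' : Path x₀ x₀ := (p.map hα).cast hα₀.symm hα₀.symm
  obtain ⟨H, hH⟩ := hp.exists_homotopy_of_map hβ (p' := γ'.map hf.1) (q' := γ)
    (fun t => hβF (p t)) fun t => hb.injective (hbβ (γ₁ t))
  refine ⟨γ', fun t => hαint (p t), H, fun z => ?_⟩
  obtain ⟨v, hv⟩ := hH z
  exact hv ▸ hβint v
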